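/- arXiv:0903.4528 — 7 statements merged into one kernel-verified Lean document; each statement's English description precedes it below -/
import Mathlib

section
/- Work on P = ℝ^n × ℝ^m with coordinates (x^1,…,x^n,y^1,…,y^m), n ≥ 1, m ≥ 1. Let ω^i_{ab} : P → ℝ (i = 1,…,n; a,b = 1,…,m) be infinitely differentiable (C^∞) functions with ω^i_{ab} = −ω^i_{ba}, and let ω_a : P → ℝ be C^∞ functions. Assume the closedness conditions hold everywhere: (C1) ∂_{y^a}ω^i_{bc} + ∂_{y^b}ω^i_{ca} + ∂_{y^c}ω^i_{ab} = 0 for all i,a,b,c, and (C2) Σ_i ∂_{x^i}ω^i_{ab} + (1/2)(∂_{y^a}ω_b − ∂_{y^b}ω_a) = 0 for all a,b. Then there exist C^∞ functions θ^i_a : P → ℝ and H : P → ℝ such that ω^i_{ab} = (1/2)(∂_{y^a}θ^i_b − ∂_{y^b}θ^i_a) and ω_a = −∂_{y^a}H − Σ_i ∂_{x^i}θ^i_a everywhere. -/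
open scoped BigOperators

/-- Partial derivative in the base direction `x^i` on `P = ℝ^n × ℝ^m`. -/
noncomputable def pdx {n m : ℕ} (i : Fin n)
    (f : (Fin n → ℝ) × (Fin m → ℝ) → ℝ) (p : (Fin n → ℝ) × (Fin m → ℝ)) : ℝ :=
  fderiv ℝ f p (Pi.single i 1, 0)

/-- Partial derivative in the fiber direction `y^a` on `P = ℝ^n × ℝ^m`. -/
noncomputable def pdy {n m : ℕ} (a : Fin m)
    (f : (Fin n → ℝ) × (Fin m → ℝ) → ℝ) (p : (Fin n → ℝ) × (Fin m → ℝ)) : ℝ :=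
  fderiv ℝ f p (0, Pi.single a 1)

/-- Differentiation under the integral sign over `[a, b]` for a jointly `C^1` integrand. -/
theorem hasFDerivAt_intervalIntegral_of_contDiff {E : Type*} [NormedAddCommGroup E]
    [NormedSpace ℝ E] [ProperSpace E] {F : E × ℝ → ℝ} (hF : ContDiff ℝ 1 F) (a b : ℝ) (p : E) :
    HasFDerivAt (fun q => ∫ t in a..b, F (q, t))
      (∫ t in a..b, (fderiv ℝ F (p, t)).comp (ContinuousLinearMap.inl ℝ E ℝ)) p := by
  have hF' : Continuous fun z : E × ℝ =>
      (fderiv ℝ F z).comp (ContinuousLinearMap.inl ℝ E ℝ) :=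
    (hF.continuous_fderiv one_ne_zero).clm_comp continuous_const
  have hsection : ∀ q : E, Continuous fun t : ℝ => F (q, t) := fun q =>
    hF.continuous.comp (by fun_prop)
  obtain ⟨C, hC⟩ := ((isCompact_closedBall p 1).prod
    (isCompact_uIcc (a := a) (b := b))).exists_bound_of_continuousOn hF'.continuousOn
  refine intervalIntegral.hasFDerivAt_integral_of_dominated_of_fderiv_le
    (F' := fun q t => (fderiv ℝ F (q, t)).comp (ContinuousLinearMap.inl ℝ E ℝ))
    (bound := fun _ => C) (Metric.closedBall_mem_nhds p one_pos)
    (.of_forall fun q => (hsection q).aestronglyMeasurable)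
    ((hsection p).intervalIntegrable _ _)
    (hF'.comp (Continuous.prodMk_right p)).aestronglyMeasurable
    (.of_forall fun t ht q hq => hC (q, t) ⟨hq, Set.uIoc_subset_uIcc ht⟩)
    intervalIntegrable_const (.of_forall fun t _ q _ => ?_)
  exact ((hF.differentiable one_ne_zero) (q, t)).hasFDerivAt.comp q (hasFDerivAt_prodMk_left q t)

theorem fderiv_intervalIntegral_of_contDiff {E : Type*} [NormedAddCommGroup E]
    [NormedSpace ℝ E] [ProperSpace E] {F : E × ℝ → ℝ} (hF : ContDiff ℝ 1 F) (a b : ℝ) (p v : E) :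
    fderiv ℝ (fun q => ∫ t in a..b, F (q, t)) p v = ∫ t in a..b, fderiv ℝ F (p, t) (v, 0) := by
  rw [(hasFDerivAt_intervalIntegral_of_contDiff hF a b p).fderiv,
    ContinuousLinearMap.intervalIntegral_apply]
  · simp
  · exact (((hF.continuous_fderiv one_ne_zero).comp
      (Continuous.prodMk_right p)).clm_comp continuous_const).intervalIntegrable _ _

theorem contDiff_intervalIntegral {E : Type*} [NormedAddCommGroup E] [NormedSpace ℝ E]
    [FiniteDimensional ℝ E] {F : E × ℝ → ℝ} (hF : ContDiff ℝ (⊤ : ℕ∞) F) (a b : ℝ) :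
    ContDiff ℝ (⊤ : ℕ∞) (fun q => ∫ t in a..b, F (q, t)) := by
  have : ProperSpace E := FiniteDimensional.proper_real E
  refine contDiff_infty.2 fun k => ?_
  induction k generalizing F with
  | zero =>
    exact contDiff_zero.2 <| continuous_iff_continuousAt.2 fun p =>
      (hasFDerivAt_intervalIntegral_of_contDiff
        (hF.of_le (mod_cast le_top)) a b p).continuousAt
  | succ k ih =>
    have hF1 : ContDiff ℝ 1 F := hF.of_le (mod_cast le_top)
    push_cast
    refine contDiff_succ_iff_fderiv_apply.2 ⟨fun p =>
      (hasFDerivAt_intervalIntegral_of_contDiff hF1 a b p).differentiableAt,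
      fun h => absurd h (by simp), fun v => ?_⟩
    simp only [fderiv_intervalIntegral_of_contDiff hF1]
    exact ih ((hF.fderiv_right (m := (⊤ : ℕ∞)) (by simp)).clm_apply contDiff_const)

section Partial

variable {n m : ℕ} {f g : (Fin n → ℝ) × (Fin m → ℝ) → ℝ}

theorem contDiff_pdx (hf : ContDiff ℝ (⊤ : ℕ∞) f) (i : Fin n) :
    ContDiff ℝ (⊤ : ℕ∞) (pdx i f) :=
  (hf.fderiv_right (m := (⊤ : ℕ∞)) (by simp)).clm_apply contDiff_const

theorem contDiff_pdy (hf : ContDiff ℝ (⊤ : ℕ∞) f) (a : Fin m) :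
    ContDiff ℝ (⊤ : ℕ∞) (pdy a f) :=
  (hf.fderiv_right (m := (⊤ : ℕ∞)) (by simp)).clm_apply contDiff_const

theorem pdy_pdx_comm (hf : ContDiff ℝ (⊤ : ℕ∞) f) (a : Fin m) (i : Fin n)
    (p : (Fin n → ℝ) × (Fin m → ℝ)) : pdy a (pdx i f) p = pdx i (pdy a f) p := by
  have hd : DifferentiableAt ℝ (fderiv ℝ f) p :=
    (hf.fderiv_right (m := (⊤ : ℕ∞)) (by simp)).differentiable (by simp) p
  have hsymm : IsSymmSndFDerivAt ℝ f p :=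
    hf.contDiffAt.isSymmSndFDerivAt <| by
      rw [minSmoothness_of_isRCLikeNormedField]
      exact WithTop.coe_le_coe.2 le_top
  change fderiv ℝ (fun q => fderiv ℝ f q _) p _ = fderiv ℝ (fun q => fderiv ℝ f q _) p _
  rw [fderiv_clm_apply hd (by fun_prop), fderiv_clm_apply hd (by fun_prop)]
  simpa using hsymm _ _

theorem pdy_add (hf : ContDiff ℝ (⊤ : ℕ∞) f) (hg : ContDiff ℝ (⊤ : ℕ∞) g) (a : Fin m)
    (p : (Fin n → ℝ) × (Fin m → ℝ)) :
    pdy a (fun q => f q + g q) p = pdy a f p + pdy a g p := by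
  simp only [pdy]
  rw [fderiv_fun_add (hf.differentiable (by simp) p) (hg.differentiable (by simp) p)]
  rfl

theorem pdy_sum {ι : Type*} {s : Finset ι} {F : ι → (Fin n → ℝ) × (Fin m → ℝ) → ℝ}
    (hF : ∀ i, ContDiff ℝ (⊤ : ℕ∞) (F i)) (a : Fin m) (p : (Fin n → ℝ) × (Fin m → ℝ)) :
    pdy a (fun q => ∑ i ∈ s, F i q) p = ∑ i ∈ s, pdy a (F i) p := by
  simp only [pdy]
  rw [fderiv_fun_sum fun i _ => (hF i).differentiable (by simp) p]
  simp

theorem pdy_const_mul (hf : ContDiff ℝ (⊤ : ℕ∞) f) (r : ℝ) (a : Fin m)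
    (p : (Fin n → ℝ) × (Fin m → ℝ)) : pdy a (fun q => r * f q) p = r * pdy a f p := by
  simp only [pdy]
  rw [fderiv_const_mul (hf.differentiable (by simp) p)]
  rfl

theorem pdx_const_mul_sub (hf : ContDiff ℝ (⊤ : ℕ∞) f) (hg : ContDiff ℝ (⊤ : ℕ∞) g) (r : ℝ)
    (i : Fin n) (p : (Fin n → ℝ) × (Fin m → ℝ)) :
    pdx i (fun q => r * (f q - g q)) p = r * (pdx i f p - pdx i g p) := by
  have hf' := hf.differentiable (by simp) p
  have hg' := hg.differentiable (by simp) p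
  simp only [pdx]
  rw [fderiv_const_mul (hf'.fun_sub hg'), fderiv_fun_sub hf' hg']
  rfl

theorem pdy_coord_mul (hf : ContDiff ℝ (⊤ : ℕ∞) f) (a b : Fin m)
    (p : (Fin n → ℝ) × (Fin m → ℝ)) :
    pdy a (fun q => q.2 b * f q) p = (if b = a then f p else 0) + p.2 b * pdy a f p := by
  have hcoord : HasFDerivAt (fun q : (Fin n → ℝ) × (Fin m → ℝ) => q.2 b)
      ((ContinuousLinearMap.proj b).comp (ContinuousLinearMap.snd ℝ _ _)) p :=
    ((ContinuousLinearMap.proj (R := ℝ) (φ := fun _ : Fin m => ℝ) b).comp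
      (ContinuousLinearMap.snd ℝ (Fin n → ℝ) (Fin m → ℝ))).hasFDerivAt
  simp only [pdy]
  rw [(hcoord.fun_mul (hf.differentiable (by simp) p).hasFDerivAt).fderiv]
  simp [Pi.single_apply, add_comm]

/-- The fiberwise radial average `(x, y) ↦ ∫ t in 0..1, t ^ k * f (x, t y)`. -/
noncomputable def fiberAverage (k : ℕ) (f : (Fin n → ℝ) × (Fin m → ℝ) → ℝ)
    (p : (Fin n → ℝ) × (Fin m → ℝ)) : ℝ :=
  ∫ t in (0 : ℝ)..1, t ^ k * f (p.1, t • p.2)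

theorem contDiff_fiberAverage_integrand (hf : ContDiff ℝ (⊤ : ℕ∞) f) (k : ℕ) :
    ContDiff ℝ (⊤ : ℕ∞)
      (fun z : ((Fin n → ℝ) × (Fin m → ℝ)) × ℝ => z.2 ^ k * f (z.1.1, z.2 • z.1.2)) := by
  fun_prop

theorem contDiff_fiberAverage (hf : ContDiff ℝ (⊤ : ℕ∞) f) (k : ℕ) :
    ContDiff ℝ (⊤ : ℕ∞) (fiberAverage k f) :=
  contDiff_intervalIntegral (contDiff_fiberAverage_integrand hf k) 0 1

theorem intervalIntegrable_fiberAverage (hf : Continuous f) (k : ℕ)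
    (p : (Fin n → ℝ) × (Fin m → ℝ)) :
    IntervalIntegrable (fun t : ℝ => t ^ k * f (p.1, t • p.2)) MeasureTheory.volume 0 1 := by
  apply Continuous.intervalIntegrable
  fun_prop

theorem pdy_fiberAverage (hf : ContDiff ℝ (⊤ : ℕ∞) f) (k : ℕ) (a : Fin m)
    (p : (Fin n → ℝ) × (Fin m → ℝ)) :
    pdy a (fiberAverage k f) p = fiberAverage (k + 1) (pdy a f) p := by
  have hF := contDiff_fiberAverage_integrand hf k
  change fderiv ℝ (fun q : (Fin n → ℝ) × (Fin m → ℝ) =>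
    ∫ t in (0 : ℝ)..1, t ^ k * f (q.1, t • q.2)) p _ = _
  rw [fderiv_intervalIntegral_of_contDiff (hF.of_le (mod_cast le_top)) 0 1]
  refine intervalIntegral.integral_congr fun t _ => ?_
  have hline : HasDerivAt (fun s : ℝ => (p.1, t • (p.2 + s • Pi.single a (1 : ℝ))))
      ((0 : Fin n → ℝ), t • Pi.single a (1 : ℝ)) 0 := by
    refine (hasDerivAt_const _ _).prodMk (HasDerivAt.const_smul t ?_)
    simpa using ((hasDerivAt_id (0 : ℝ)).smul_const (Pi.single a (1 : ℝ))).const_add p.2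
  have hleft := (hF.differentiable (by simp) (p, t)).hasFDerivAt.hasLineDerivAt
    ((0, Pi.single a 1), 0)
  have hright := ((hf.differentiable (by simp) (p.1, t • p.2)).hasFDerivAt.comp_hasDerivAt_of_eq
    (0 : ℝ) hline (by simp)).const_mul (t ^ k)
  have heq := HasDerivAt.unique hleft (by simpa [Function.comp_def] using hright)
  have hsmul : ((0 : Fin n → ℝ), t • Pi.single a (1 : ℝ)) = t • (0, Pi.single a 1) := by simp
  rw [heq, hsmul, map_smul, smul_eq_mul]
  simp only [pdy]
  ring

/-- Euler's identity integrated along the rays of the fibers. -/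
theorem fiberAverage_euler (hf : ContDiff ℝ (⊤ : ℕ∞) f) (k : ℕ)
    (p : (Fin n → ℝ) × (Fin m → ℝ)) :
    (k + 1) * fiberAverage k f p + ∑ a, p.2 a * fiberAverage (k + 1) (pdy a f) p = f p := by
  have hint := intervalIntegrable_fiberAverage hf.continuous k p
  have hint' := fun a => intervalIntegrable_fiberAverage (contDiff_pdy hf a).continuous (k + 1) p
  have hsum : IntervalIntegrable (fun t : ℝ => ∑ a, p.2 a * (t ^ (k + 1) *
      pdy a f (p.1, t • p.2))) MeasureTheory.volume 0 1 := by
    simpa only [Finset.sum_fn] using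
      IntervalIntegrable.sum Finset.univ fun a _ => (hint' a).const_mul (p.2 a)
  simp only [fiberAverage, ← intervalIntegral.integral_const_mul]
  rw [← intervalIntegral.integral_finsetSum fun a _ => (hint' a).const_mul _,
    ← intervalIntegral.integral_add (hint.const_mul _) hsum]
  have hderiv : ∀ t ∈ Set.uIcc (0 : ℝ) 1,
      HasDerivAt (fun t : ℝ => t ^ (k + 1) * f (p.1, t • p.2))
        ((k + 1) * (t ^ k * f (p.1, t • p.2)) +
          ∑ a, p.2 a * (t ^ (k + 1) * pdy a f (p.1, t • p.2))) t := by
    intro t _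
    have hline : HasDerivAt (fun s : ℝ => (p.1, s • p.2)) ((0 : Fin n → ℝ), p.2) t := by
      refine (hasDerivAt_const _ _).prodMk ?_
      simpa using (hasDerivAt_id t).smul_const p.2
    have hprod := (hasDerivAt_pow (k + 1) t).mul
      ((hf.differentiable (by simp) (p.1, t • p.2)).hasFDerivAt.comp_hasDerivAt t hline)
    have hbasis : ((0 : Fin n → ℝ), p.2) = ∑ a, p.2 a • (0, Pi.single a (1 : ℝ)) := by
      ext j <;> simp [Prod.fst_sum, Prod.snd_sum, Pi.single_apply]
    refine hprod.congr_deriv ?_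
    rw [hbasis, map_sum]
    simp only [map_smul, smul_eq_mul, Finset.mul_sum, pdy, Function.comp_apply]
    push_cast
    congr 1
    · ring
    · exact Finset.sum_congr rfl fun a _ => by ring
  rw [intervalIntegral.integral_eq_sub_of_hasDerivAt hderiv]
  · simp
  · exact (hint.const_mul _).add hsum

/-- Contraction of the fiberwise form with coefficients `η` with the radial field, averaged with
weight `t ^ k`. -/
noncomputable def radialPrimitive (k : ℕ) (η : Fin m → (Fin n → ℝ) × (Fin m → ℝ) → ℝ)
    (p : (Fin n → ℝ) × (Fin m → ℝ)) : ℝ :=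
  ∑ b, p.2 b * fiberAverage k (η b) p

theorem contDiff_radialPrimitive {η : Fin m → (Fin n → ℝ) × (Fin m → ℝ) → ℝ}
    (hη : ∀ b, ContDiff ℝ (⊤ : ℕ∞) (η b)) (k : ℕ) :
    ContDiff ℝ (⊤ : ℕ∞) (radialPrimitive k η) := by
  have := fun b => contDiff_fiberAverage (hη b) k
  unfold radialPrimitive
  fun_prop

theorem pdy_radialPrimitive {η : Fin m → (Fin n → ℝ) × (Fin m → ℝ) → ℝ}
    (hη : ∀ b, ContDiff ℝ (⊤ : ℕ∞) (η b)) (k : ℕ) (a : Fin m)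
    (p : (Fin n → ℝ) × (Fin m → ℝ)) :
    pdy a (radialPrimitive k η) p =
      fiberAverage k (η a) p + ∑ b, p.2 b * fiberAverage (k + 1) (pdy a (η b)) p := by
  have hsmooth := fun b => contDiff_fiberAverage (hη b) k
  unfold radialPrimitive
  rw [pdy_sum (F := fun b q => q.2 b * fiberAverage k (η b) q) fun b => by fun_prop]
  simp [pdy_coord_mul (hsmooth _), pdy_fiberAverage (hη _), Finset.sum_add_distrib]

theorem pdy_radialPrimitive_of_closed {η : Fin m → (Fin n → ℝ) × (Fin m → ℝ) → ℝ}
    (hη : ∀ b, ContDiff ℝ (⊤ : ℕ∞) (η b))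
    (hclosed : ∀ a b p, pdy a (η b) p = pdy b (η a) p) (a : Fin m)
    (p : (Fin n → ℝ) × (Fin m → ℝ)) : pdy a (radialPrimitive 0 η) p = η a p := by
  rw [pdy_radialPrimitive hη, ← fiberAverage_euler (hη a) 0 p]
  simp only [funext (hclosed a _)]
  simp

theorem fiberAverage_neg (k : ℕ) (p : (Fin n → ℝ) × (Fin m → ℝ)) :
    fiberAverage k (fun q => -f q) p = -fiberAverage k f p := by
  simp [fiberAverage]

theorem fiberAverage_sub (hf : Continuous f) (hg : Continuous g) (k : ℕ)
    (p : (Fin n → ℝ) × (Fin m → ℝ)) :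
    fiberAverage k (fun q => f q - g q) p = fiberAverage k f p - fiberAverage k g p := by
  simp only [fiberAverage, mul_sub]
  exact intervalIntegral.integral_sub (intervalIntegrable_fiberAverage hf k p)
    (intervalIntegrable_fiberAverage hg k p)

theorem pdy_radialPrimitive_sub_of_closed
    {ω : Fin m → Fin m → (Fin n → ℝ) × (Fin m → ℝ) → ℝ}
    (hω : ∀ a b, ContDiff ℝ (⊤ : ℕ∞) (ω a b)) (hskew : ∀ a b p, ω a b p = -ω b a p)
    (hclosed : ∀ a b c p, pdy a (ω b c) p + pdy b (ω c a) p + pdy c (ω a b) p = 0)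
    (a b : Fin m) (p : (Fin n → ℝ) × (Fin m → ℝ)) :
    pdy a (radialPrimitive 1 fun c => ω c b) p - pdy b (radialPrimitive 1 fun c => ω c a) p =
      ω a b p := by
  have hneg : ∀ a b c q, pdy c (ω a b) q = -pdy c (ω b a) q := fun a b c q => by
    rw [show ω a b = fun q => -1 * ω b a q by funext r; rw [hskew]; ring,
      pdy_const_mul (hω b a)]
    ring
  have hcyc : ∀ c, pdy c (ω a b) = fun q => pdy a (ω c b) q - pdy b (ω c a) q := fun c => by
    funext q
    linarith [hclosed a b c q, hneg b c a q]
  have hcont := fun a b c => (contDiff_pdy (hω a b) c).continuous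
  rw [pdy_radialPrimitive fun c => hω c b, pdy_radialPrimitive fun c => hω c a,
    ← fiberAverage_euler (hω a b) 1 p, show ω b a = fun q => -ω a b q from funext (hskew b a),
    fiberAverage_neg]
  simp only [hcyc, fiberAverage_sub (hcont _ _ _) (hcont _ _ _), mul_sub, Finset.sum_sub_distrib]
  push_cast
  ring

end Partial

/-- Affine Poincaré lemma in coordinates on the trivial bundle
`ℝ^n × ℝ^m → ℝ^n`: a δ-closed affine 2-form `ω` is δ-exact, with potential
`θ = θ^i_a dy^a d^{n-1}x_i − H d^n x`. -/
theorem stmt_2 (n m : ℕ) (hn : 1 ≤ n) (hm : 1 ≤ m)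
    (ω : Fin n → Fin m → Fin m → ((Fin n → ℝ) × (Fin m → ℝ)) → ℝ)
    (ω₀ : Fin m → ((Fin n → ℝ) × (Fin m → ℝ)) → ℝ)
    (hωsmooth : ∀ i a b, ContDiff ℝ (⊤ : ℕ∞) (ω i a b))
    (hω₀smooth : ∀ a, ContDiff ℝ (⊤ : ℕ∞) (ω₀ a))
    (hskew : ∀ i a b p, ω i a b p = - ω i b a p)
    (hC1 : ∀ i a b c p, pdy a (ω i b c) p + pdy b (ω i c a) p + pdy c (ω i a b) p = 0)
    (hC2 : ∀ a b p,
      (∑ i, pdx i (ω i a b) p) + (1 / 2) * (pdy a (ω₀ b) p - pdy b (ω₀ a) p) = 0) :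
    ∃ (θ : Fin n → Fin m → ((Fin n → ℝ) × (Fin m → ℝ)) → ℝ)
      (H : ((Fin n → ℝ) × (Fin m → ℝ)) → ℝ),
      (∀ i a, ContDiff ℝ (⊤ : ℕ∞) (θ i a)) ∧ ContDiff ℝ (⊤ : ℕ∞) H ∧
      (∀ i a b p, ω i a b p = (1 / 2) * (pdy a (θ i b) p - pdy b (θ i a) p)) ∧
      (∀ a p, ω₀ a p = - pdy a H p - ∑ i, pdx i (θ i a) p) := by
  have hprim : ∀ i b, ContDiff ℝ (⊤ : ℕ∞) (radialPrimitive 1 fun c => ω i c b) :=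
    fun i b => contDiff_radialPrimitive (fun c => hωsmooth i c b) 1
  obtain ⟨θ, hθ, hθω⟩ : ∃ θ : Fin n → Fin m → ((Fin n → ℝ) × (Fin m → ℝ)) → ℝ,
      (∀ i a, ContDiff ℝ (⊤ : ℕ∞) (θ i a)) ∧
      ∀ i a b p, ω i a b p = (1 / 2) * (pdy a (θ i b) p - pdy b (θ i a) p) := by
    refine ⟨fun i b q => 2 * radialPrimitive 1 (fun c => ω i c b) q,
      fun i b => contDiff_const.mul (hprim i b), fun i a b p => ?_⟩
    rw [pdy_const_mul (hprim i b), pdy_const_mul (hprim i a),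
      ← pdy_radialPrimitive_sub_of_closed (hωsmooth i) (hskew i) (hC1 i) a b p]
    ring
  have hdiv : ∀ a, ContDiff ℝ (⊤ : ℕ∞) fun q => ∑ i, pdx i (θ i a) q :=
    fun a => ContDiff.sum fun i _ => contDiff_pdx (hθ i a) i
  have hη : ∀ a, ContDiff ℝ (⊤ : ℕ∞) fun q => ω₀ a q + ∑ i, pdx i (θ i a) q :=
    fun a => (hω₀smooth a).add (hdiv a)
  have hclosed : ∀ a b p, pdy a (fun q => ω₀ b q + ∑ i, pdx i (θ i b) q) p =
      pdy b (fun q => ω₀ a q + ∑ i, pdx i (θ i a) q) p := by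
    intro a b p
    rw [pdy_add (hω₀smooth b) (hdiv b), pdy_add (hω₀smooth a) (hdiv a),
      pdy_sum fun i => contDiff_pdx (hθ i b) i, pdy_sum fun i => contDiff_pdx (hθ i a) i]
    have h := hC2 a b p
    simp only [funext (hθω _ a b), pdx_const_mul_sub (contDiff_pdy (hθ _ b) a)
      (contDiff_pdy (hθ _ a) b), ← pdy_pdx_comm (hθ _ _), ← Finset.mul_sum,
      Finset.sum_sub_distrib] at h
    linarith
  have hH := contDiff_radialPrimitive hη 0
  refine ⟨θ, fun q => -1 * radialPrimitive 0 (fun a q => ω₀ a q + ∑ i, pdx i (θ i a) q) q,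
    hθ, contDiff_const.mul hH, hθω, fun a p => ?_⟩
  rw [pdy_const_mul hH, pdy_radialPrimitive_of_closed hη hclosed]
  ring
end

section
/- Work on P = ℝ^n × ℝ^m with coordinates (x^1,…,x^n,y^1,…,y^m), n ≥ 1, m ≥ 1. Let ω^i_{ab} : P → ℝ (i = 1,…,n; a,b = 1,…,m) be infinitely differentiable (C^∞) functions with ω^i_{ab} = −ω^i_{ba}, and let ω_a : P → ℝ be C^∞ functions, satisfying the closedness conditions (C1) ∂_{y^a}ω^i_{bc} + ∂_{y^b}ω^i_{ca} + ∂_{y^c}ω^i_{ab} = 0 and (C2) Σ_i ∂_{x^i}ω^i_{ab} + (1/2)(∂_{y^a}ω_b − ∂_{y^b}ω_a) = 0. Let Y^a : P → ℝ and f^i : P → ℝ be C^∞ functions such that ∂_{y^b}f^i = 2 Σ_a ω^i_{ab} Y^a for all i,b and Σ_i ∂_{x^i}f^i = Σ_a ω_a Y^a. Let σ : ℝ^n → ℝ^m be a C^∞ map satisfying the PD-Hamilton equations: 2 Σ_{i,a} ω^i_{ab}(x,σ(x)) ∂_{x^i}σ^a(x) − ω_b(x,σ(x)) = 0 for all b and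 x. Then the current is conserved along σ: Σ_i (d/dx^i)[ f^i(x,σ(x)) ] = 0 for all x ∈ ℝ^n. -/
open scoped BigOperators

/-- Chain rule for the total derivative of `g` along the section `x ↦ (x, σ x)`. -/
lemma fderiv_comp_section {n m : ℕ} {g : (Fin n → ℝ) × (Fin m → ℝ) → ℝ}
    {σ : (Fin n → ℝ) → (Fin m → ℝ)} {x : Fin n → ℝ} (i : Fin n)
    (hg : DifferentiableAt ℝ g (x, σ x)) (hσ : DifferentiableAt ℝ σ x) :
    fderiv ℝ (fun x' => g (x', σ x')) x (Pi.single i 1) =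
      pdx i g (x, σ x) +
        ∑ a, pdy a g (x, σ x) * fderiv ℝ (fun x' => σ x' a) x (Pi.single i 1) := by
  have hcomp : HasFDerivAt (fun x' => g (x', σ x'))
      ((fderiv ℝ g (x, σ x)).comp ((ContinuousLinearMap.id ℝ _).prod (fderiv ℝ σ x))) x :=
    hg.hasFDerivAt.comp x ((hasFDerivAt_id x).prodMk hσ.hasFDerivAt)
  have hcoord : ∀ a, fderiv ℝ (fun x' => σ x' a) x (Pi.single i 1) =
      fderiv ℝ σ x (Pi.single i 1) a := fun a => by
    rw [((hasFDerivAt_pi'.1 hσ.hasFDerivAt) a).fderiv]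
    rfl
  have hsplit : ∀ v : Fin m → ℝ, ((Pi.single i 1, v) : (Fin n → ℝ) × (Fin m → ℝ)) =
      (Pi.single i 1, 0) + ∑ a, v a • ((0, Pi.single a 1) : (Fin n → ℝ) × (Fin m → ℝ)) := by
    intro v
    ext j
    · simp [Prod.fst_sum]
    · simp [Prod.snd_sum, Finset.sum_apply, Pi.single_apply]
  rw [hcomp.fderiv]
  simp only [ContinuousLinearMap.comp_apply, ContinuousLinearMap.prod_apply,
    ContinuousLinearMap.id_apply]
  rw [hsplit, map_add, map_sum]
  simp only [map_smul, smul_eq_mul, hcoord, pdx, pdy, mul_comm]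

/-- PD-Noether theorem in coordinates on the trivial bundle
`ℝ^n × ℝ^m → ℝ^n`: if `(Y, f)` is a PD-Noether symmetry/current pair of the
δ-closed affine 2-form `ω`, then along every solution `σ` of the PD-Hamilton
equations the current `f` has vanishing total divergence. -/
theorem stmt_5 (n m : ℕ) (hn : 1 ≤ n) (hm : 1 ≤ m)
    (ω : Fin n → Fin m → Fin m → ((Fin n → ℝ) × (Fin m → ℝ)) → ℝ)
    (ω₀ : Fin m → ((Fin n → ℝ) × (Fin m → ℝ)) → ℝ)
    (hωsmooth : ∀ i a b, ContDiff ℝ (⊤ : ℕ∞) (ω i a b))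
    (hω₀smooth : ∀ a, ContDiff ℝ (⊤ : ℕ∞) (ω₀ a))
    (hskew : ∀ i a b p, ω i a b p = - ω i b a p)
    (hC1 : ∀ i a b c p, pdy a (ω i b c) p + pdy b (ω i c a) p + pdy c (ω i a b) p = 0)
    (hC2 : ∀ a b p,
      (∑ i, pdx i (ω i a b) p) + (1 / 2) * (pdy a (ω₀ b) p - pdy b (ω₀ a) p) = 0)
    (Y : Fin m → ((Fin n → ℝ) × (Fin m → ℝ)) → ℝ)
    (f : Fin n → ((Fin n → ℝ) × (Fin m → ℝ)) → ℝ)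
    (hY : ∀ a, ContDiff ℝ (⊤ : ℕ∞) (Y a)) (hf : ∀ i, ContDiff ℝ (⊤ : ℕ∞) (f i))
    (hNoether₁ : ∀ i b p, pdy b (f i) p = 2 * ∑ a, ω i a b p * Y a p)
    (hNoether₂ : ∀ p, (∑ i, pdx i (f i) p) = ∑ a, ω₀ a p * Y a p)
    (σ : (Fin n → ℝ) → (Fin m → ℝ)) (hσ : ContDiff ℝ (⊤ : ℕ∞) σ)
    (hHam : ∀ (b : Fin m) (x : Fin n → ℝ),
      2 * (∑ i, ∑ a, ω i a b (x, σ x) *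
        fderiv ℝ (fun x' => σ x' a) x (Pi.single i 1)) - ω₀ b (x, σ x) = 0) :
    ∀ x : Fin n → ℝ,
      (∑ i, fderiv ℝ (fun x' => f i (x', σ x')) x (Pi.single i 1)) = 0 := by
  intro x
  have hchain := fun i => fderiv_comp_section (x := x) i
    (((hf i).differentiable (by simp)).differentiableAt)
    ((hσ.differentiable (by simp)).differentiableAt)
  simp only [hchain, Finset.sum_add_distrib, hNoether₂, hNoether₁]
  have hfiber : ∑ i, ∑ b, (2 * ∑ a, ω i a b (x, σ x) * Y a (x, σ x)) *
        fderiv ℝ (fun x' => σ x' b) x (Pi.single i 1) =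
      ∑ a, -(2 * ∑ i, ∑ b, ω i b a (x, σ x) *
        fderiv ℝ (fun x' => σ x' b) x (Pi.single i 1)) * Y a (x, σ x) := by
    simp only [Finset.mul_sum, Finset.sum_mul, ← Finset.sum_neg_distrib]
    rw [Finset.sum_comm (s := (Finset.univ : Finset (Fin m)))]
    refine Finset.sum_congr rfl fun i _ => ?_
    rw [Finset.sum_comm]
    refine Finset.sum_congr rfl fun a _ => Finset.sum_congr rfl fun b _ => ?_
    rw [hskew i a b]
    ring
  rw [hfiber, ← Finset.sum_add_distrib]
  refine Finset.sum_eq_zero fun a _ => ?_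
  linear_combination (-Y a (x, σ x)) * hHam a x
end

section
/- Work on P = ℝ^n × ℝ^m with coordinates (x^1,…,x^n,y^1,…,y^m), n ≥ 1, m ≥ 1. Let ω^i_{ab} : P → ℝ be infinitely differentiable (C^∞) with ω^i_{ab} = −ω^i_{ba}, and ω_a : P → ℝ be C^∞, satisfying (C1) ∂_{y^a}ω^i_{bc} + ∂_{y^b}ω^i_{ca} + ∂_{y^c}ω^i_{ab} = 0 and (C2) Σ_i ∂_{x^i}ω^i_{ab} + (1/2)(∂_{y^a}ω_b − ∂_{y^b}ω_a) = 0. Call (Y,f), with Y^a, f^i C^∞ functions on P, a PD-Noether pair iff ∂_{y^b}f^i = 2 Σ_a ω^i_{ab} Y^a for all i,b and Σ_i ∂_{x^i}f^i = Σ_a ω_a Y^a. Let (Y₁,f₁) and (Y₂,f₂) be PD-Noether pairs. Define Y^a := Σ_c ( Y₁^c ∂_{y^c}Y₂^a − Y₂^c ∂_{y^c}Y₁^a ) and f^i := Σ_a Y₁^a ∂_{y^a}f₂^i. Then: (1) (Y,f) is again a PD-Noether pair; (2) f does not depend on the choice of symmetry relative to f₁: if (Y₁',f₁) is also a PD-Noether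 pair (same f₁), then Σ_a Y₁^a ∂_{y^a}f₂^i = Σ_a Y₁'^a ∂_{y^a}f₂^i for all i, everywhere on P. -/
open scoped BigOperators

/-- A PD-Noether pair `(Y, f)` for the affine 2-form with coefficients `(ω, ω₀)`:
`Y^a`, `f^i` are C^∞ and `i_Y ω = δ f` holds in coordinates. -/
noncomputable def NoetherPair {n m : ℕ}
    (ω : Fin n → Fin m → Fin m → ((Fin n → ℝ) × (Fin m → ℝ)) → ℝ)
    (ω₀ : Fin m → ((Fin n → ℝ) × (Fin m → ℝ)) → ℝ)
    (Y : Fin m → ((Fin n → ℝ) × (Fin m → ℝ)) → ℝ)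
    (f : Fin n → ((Fin n → ℝ) × (Fin m → ℝ)) → ℝ) : Prop :=
  (∀ a, ContDiff ℝ (⊤ : ℕ∞) (Y a)) ∧ (∀ i, ContDiff ℝ (⊤ : ℕ∞) (f i)) ∧
  (∀ i b p, pdy b (f i) p = 2 * ∑ a, ω i a b p * Y a p) ∧
  (∀ p, (∑ i, pdx i (f i) p) = ∑ a, ω₀ a p * Y a p)

section DirectionalDerivative

variable {E : Type*} [NormedAddCommGroup E] [NormedSpace ℝ E]

theorem fderiv_sum_mul_apply {ι : Type*} [Fintype ι] {g h : ι → E → ℝ}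
    (hg : ∀ a, ContDiff ℝ (⊤ : ℕ∞) (g a)) (hh : ∀ a, ContDiff ℝ (⊤ : ℕ∞) (h a)) (p v : E) :
    fderiv ℝ (fun q => ∑ a, g a q * h a q) p v =
      ∑ a, (fderiv ℝ (g a) p v * h a p + g a p * fderiv ℝ (h a) p v) := by
  have hg' a : DifferentiableAt ℝ (g a) p := (hg a).differentiable (by simp) p
  have hh' a : DifferentiableAt ℝ (h a) p := (hh a).differentiable (by simp) p
  rw [fderiv_fun_sum fun a _ => (hg' a).fun_mul (hh' a), sum_apply]
  refine Finset.sum_congr rfl fun a _ => ?_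
  rw [fderiv_fun_mul (hg' a) (hh' a)]
  simp only [add_apply, smul_apply, smul_eq_mul]
  ring

theorem ContDiff.fderiv_apply_const {f : E → ℝ} (hf : ContDiff ℝ (⊤ : ℕ∞) f) (v : E) :
    ContDiff ℝ (⊤ : ℕ∞) fun q => fderiv ℝ f q v :=
  (hf.fderiv_right (by simp)).clm_apply contDiff_const

theorem ContDiff.fderiv_fderiv_comm {f : E → ℝ} (hf : ContDiff ℝ (⊤ : ℕ∞) f) (p v w : E) :
    fderiv ℝ (fun q => fderiv ℝ f q v) p w = fderiv ℝ (fun q => fderiv ℝ f q w) p v := by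
  have hd : DifferentiableAt ℝ (fderiv ℝ f) p :=
    (hf.fderiv_right (m := 1) (by norm_cast)).differentiable (by simp) p
  have hs : IsSymmSndFDerivAt ℝ f p :=
    hf.contDiffAt.isSymmSndFDerivAt (by simp [minSmoothness_of_isRCLikeNormedField]; norm_cast)
  rw [fderiv_clm_apply hd (differentiableAt_const v),
    fderiv_clm_apply hd (differentiableAt_const w)]
  simpa using hs w v

end DirectionalDerivative

theorem ContDiff.pdx {n m : ℕ} {f : (Fin n → ℝ) × (Fin m → ℝ) → ℝ}
    (hf : ContDiff ℝ (⊤ : ℕ∞) f) (i : Fin n) : ContDiff ℝ (⊤ : ℕ∞) (pdx i f) :=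
  hf.fderiv_apply_const _

theorem ContDiff.pdy {n m : ℕ} {f : (Fin n → ℝ) × (Fin m → ℝ) → ℝ}
    (hf : ContDiff ℝ (⊤ : ℕ∞) f) (a : Fin m) : ContDiff ℝ (⊤ : ℕ∞) (pdy a f) :=
  hf.fderiv_apply_const _

/-- Contraction of the covector `w` with the commutator of `u` and `v`, whose Jacobians are
`U` and `V`. -/
theorem sum_mul_commutator {m : ℕ} (w u v : Fin m → ℝ) (U V : Fin m → Fin m → ℝ) :
    ∑ a, w a * ∑ c, (u c * V c a - v c * U c a) =
      ∑ a, ∑ c, (w c * u a * V a c - w a * v c * U c a) := by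
  simp only [Finset.mul_sum, mul_sub, Finset.sum_sub_distrib, ← mul_assoc]
  rw [Finset.sum_comm]

namespace NoetherPair

variable {n m : ℕ} {ω : Fin n → Fin m → Fin m → ((Fin n → ℝ) × (Fin m → ℝ)) → ℝ}
  {ω₀ : Fin m → ((Fin n → ℝ) × (Fin m → ℝ)) → ℝ}
  {Y Y₁ Y₂ : Fin m → ((Fin n → ℝ) × (Fin m → ℝ)) → ℝ}
  {f f₁ f₂ : Fin n → ((Fin n → ℝ) × (Fin m → ℝ)) → ℝ}

theorem fderiv_pdy (hω : ∀ i a b, ContDiff ℝ (⊤ : ℕ∞) (ω i a b)) (h : NoetherPair ω ω₀ Y f)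
    (i : Fin n) (b : Fin m) (p v : (Fin n → ℝ) × (Fin m → ℝ)) :
    fderiv ℝ (pdy b (f i)) p v =
      2 * ∑ a, (fderiv ℝ (ω i a b) p v * Y a p + ω i a b p * fderiv ℝ (Y a) p v) := by
  obtain ⟨hY, -, hv, -⟩ := h
  rw [funext (hv i b), ← fderiv_sum_mul_apply (fun a => hω i a b) hY, fderiv_const_mul]
  · rfl
  · exact (ContDiff.sum fun a _ => (hω i a b).mul (hY a)).differentiable (by simp) p

theorem sum_pdx_pdy (hω₀ : ∀ a, ContDiff ℝ (⊤ : ℕ∞) (ω₀ a)) (h : NoetherPair ω ω₀ Y f)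
    (b : Fin m) (p : (Fin n → ℝ) × (Fin m → ℝ)) :
    ∑ i, pdx i (pdy b (f i)) p = ∑ a, (pdy b (ω₀ a) p * Y a p + ω₀ a p * pdy b (Y a) p) := by
  obtain ⟨hY, hf, -, hh⟩ := h
  calc ∑ i, pdx i (pdy b (f i)) p
      = ∑ i, fderiv ℝ (pdx i (f i)) p (0, Pi.single b 1) :=
        Finset.sum_congr rfl fun i _ => (hf i).fderiv_fderiv_comm _ _ _
    _ = fderiv ℝ (fun q => ∑ i, pdx i (f i) q) p (0, Pi.single b 1) := by
        rw [fderiv_fun_sum fun i _ =>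
          ((hf i).pdx i).differentiable (by simp) p, sum_apply]
    _ = _ := by
        rw [funext hh]
        exact fderiv_sum_mul_apply hω₀ hY _ _

/-- The Lie derivative of a current along a Noether symmetry is skew in the two pairs. -/
theorem sum_mul_pdy_antisymm (hskew : ∀ i a b p, ω i a b p = -ω i b a p)
    (h₁ : NoetherPair ω ω₀ Y₁ f₁) (h₂ : NoetherPair ω ω₀ Y₂ f₂)
    (i : Fin n) (p : (Fin n → ℝ) × (Fin m → ℝ)) :
    ∑ a, Y₁ a p * pdy a (f₂ i) p = -∑ a, Y₂ a p * pdy a (f₁ i) p := by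
  simp only [h₁.2.2.1, h₂.2.2.1, Finset.mul_sum, ← Finset.sum_neg_distrib]
  rw [Finset.sum_comm]
  refine Finset.sum_congr rfl fun a _ => Finset.sum_congr rfl fun c _ => ?_
  rw [hskew i a c]
  ring

theorem pdy_lieDerivative (hω : ∀ i a b, ContDiff ℝ (⊤ : ℕ∞) (ω i a b))
    (hskew : ∀ i a b p, ω i a b p = -ω i b a p)
    (hC1 : ∀ i a b c p, pdy a (ω i b c) p + pdy b (ω i c a) p + pdy c (ω i a b) p = 0)
    (h₁ : NoetherPair ω ω₀ Y₁ f₁) (h₂ : NoetherPair ω ω₀ Y₂ f₂)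
    (i : Fin n) (b : Fin m) (p : (Fin n → ℝ) × (Fin m → ℝ)) :
    pdy b (fun q => ∑ a, Y₁ a q * pdy a (f₂ i) q) p =
      2 * ∑ a, ω i a b p * ∑ c, (Y₁ c p * pdy c (Y₂ a) p - Y₂ c p * pdy c (Y₁ a) p) := by
  have hL : pdy b (fun q => ∑ a, Y₁ a q * pdy a (f₂ i) q) p =
      ∑ a, ∑ c, (pdy b (Y₁ a) p * (2 * (ω i c a p * Y₂ c p)) +
        Y₁ a p * (2 * (pdy a (ω i c b) p * Y₂ c p + ω i c b p * pdy a (Y₂ c) p))) := by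
    rw [pdy, fderiv_sum_mul_apply h₁.1 fun a => (h₂.2.1 i).pdy a]
    refine Finset.sum_congr rfl fun a _ => ?_
    have hc : fderiv ℝ (pdy a (f₂ i)) p (0, Pi.single b 1) =
        fderiv ℝ (pdy b (f₂ i)) p (0, Pi.single a 1) := (h₂.2.1 i).fderiv_fderiv_comm _ _ _
    rw [hc, h₂.fderiv_pdy hω, h₂.2.2.1 i a p]
    simp only [Finset.mul_sum]
    rw [← Finset.sum_add_distrib]
    rfl
  have hclosed : ∑ a, ∑ c, Y₂ c p *
      ((pdy c (ω i a b) p * Y₁ a p + ω i a b p * pdy c (Y₁ a) p) -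
        (pdy b (ω i a c) p * Y₁ a p + ω i a c p * pdy b (Y₁ a) p)) = 0 := by
    rw [Finset.sum_comm]
    refine Finset.sum_eq_zero fun c _ => ?_
    have hc : fderiv ℝ (pdy b (f₁ i)) p (0, Pi.single c 1) =
        fderiv ℝ (pdy c (f₁ i)) p (0, Pi.single b 1) := (h₁.2.1 i).fderiv_fderiv_comm _ _ _
    rw [h₁.fderiv_pdy hω, h₁.fderiv_pdy hω] at hc
    rw [← Finset.mul_sum, Finset.sum_sub_distrib]
    exact mul_eq_zero_of_right _ (sub_eq_zero.mpr (mul_left_cancel₀ two_ne_zero hc))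
  rw [hL, sum_mul_commutator (fun a => ω i a b p) (fun a => Y₁ a p) (fun a => Y₂ a p)
    (fun c a => pdy c (Y₁ a) p) (fun c a => pdy c (Y₂ a) p), ← sub_eq_zero,
    ← mul_eq_zero_of_right 2 hclosed]
  simp only [Finset.mul_sum, ← Finset.sum_sub_distrib]
  refine Finset.sum_congr rfl fun a _ => Finset.sum_congr rfl fun c _ => ?_
  have hba : pdy c (ω i b a) p = -pdy c (ω i a b) p := by
    rw [funext (hskew i b a), pdy, fderiv_fun_neg]
    rfl
  have h := hC1 i a c b p
  rw [hba] at h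
  rw [hskew i a c]
  linear_combination 2 * Y₁ a p * Y₂ c p * h

theorem sum_pdx_lieDerivative (hω : ∀ i a b, ContDiff ℝ (⊤ : ℕ∞) (ω i a b))
    (hω₀ : ∀ a, ContDiff ℝ (⊤ : ℕ∞) (ω₀ a))
    (hskew : ∀ i a b p, ω i a b p = -ω i b a p)
    (hC2 : ∀ a b p,
      (∑ i, pdx i (ω i a b) p) + (1 / 2) * (pdy a (ω₀ b) p - pdy b (ω₀ a) p) = 0)
    (h₁ : NoetherPair ω ω₀ Y₁ f₁) (h₂ : NoetherPair ω ω₀ Y₂ f₂)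
    (p : (Fin n → ℝ) × (Fin m → ℝ)) :
    ∑ i, pdx i (fun q => ∑ a, Y₁ a q * pdy a (f₂ i) q) p =
      ∑ a, ω₀ a p * ∑ c, (Y₁ c p * pdy c (Y₂ a) p - Y₂ c p * pdy c (Y₁ a) p) := by
  have hL : ∑ i, pdx i (fun q => ∑ a, Y₁ a q * pdy a (f₂ i) q) p =
      ∑ a, ∑ c, (2 * (∑ i, ω i c a p * pdx i (Y₁ a) p) * Y₂ c p +
        Y₁ a p * (pdy a (ω₀ c) p * Y₂ c p + ω₀ c p * pdy a (Y₂ c) p)) := by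
    have hi i : pdx i (fun q => ∑ a, Y₁ a q * pdy a (f₂ i) q) p =
        ∑ a, (pdx i (Y₁ a) p * pdy a (f₂ i) p + Y₁ a p * pdx i (pdy a (f₂ i)) p) :=
      fderiv_sum_mul_apply h₁.1 (fun a => (h₂.2.1 i).pdy a) _ _
    simp only [hi]
    rw [Finset.sum_comm]
    refine Finset.sum_congr rfl fun a _ => ?_
    rw [Finset.sum_add_distrib, Finset.sum_add_distrib, ← Finset.mul_sum, ← Finset.mul_sum,
      h₂.sum_pdx_pdy hω₀]
    simp only [h₂.2.2.1, Finset.mul_sum, Finset.sum_mul]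
    congr 1
    rw [Finset.sum_comm]
    refine Finset.sum_congr rfl fun c _ => Finset.sum_congr rfl fun i _ => ?_
    ring
  have hclosed : ∑ a, ∑ c, Y₂ c p *
      ((pdy c (ω₀ a) p * Y₁ a p + ω₀ a p * pdy c (Y₁ a) p) -
        2 * ((∑ i, pdx i (ω i a c) p) * Y₁ a p + ∑ i, ω i a c p * pdx i (Y₁ a) p)) = 0 := by
    rw [Finset.sum_comm]
    refine Finset.sum_eq_zero fun c _ => ?_
    have hc := h₁.sum_pdx_pdy hω₀ c p
    have hi i : pdx i (pdy c (f₁ i)) p =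
        2 * ∑ a, (pdx i (ω i a c) p * Y₁ a p + ω i a c p * pdx i (Y₁ a) p) :=
      h₁.fderiv_pdy hω i c p _
    simp only [hi] at hc
    rw [← Finset.mul_sum, Finset.sum_sub_distrib, ← hc, ← Finset.mul_sum, ← Finset.mul_sum,
      Finset.sum_comm]
    simp only [Finset.sum_add_distrib, Finset.sum_mul, sub_self, mul_zero]
  rw [hL, sum_mul_commutator (fun a => ω₀ a p) (fun a => Y₁ a p) (fun a => Y₂ a p)
    (fun c a => pdy c (Y₁ a) p) (fun c a => pdy c (Y₂ a) p), ← sub_eq_zero, ← hclosed]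
  simp only [← Finset.sum_sub_distrib]
  refine Finset.sum_congr rfl fun a _ => Finset.sum_congr rfl fun c _ => ?_
  have hac : ∑ i, ω i a c p * pdx i (Y₁ a) p = -∑ i, ω i c a p * pdx i (Y₁ a) p := by
    simp only [hskew _ a c, neg_mul, Finset.sum_neg_distrib]
  rw [hac]
  linear_combination 2 * Y₁ a p * Y₂ c p * hC2 a c p

end NoetherPair

/-- the commutator of two PD-Noether symmetries, together with the
Lie derivative of the second current along the first symmetry, is again a
PD-Noether pair; moreover the resulting current does not depend on the choice
of symmetry relative to the first current. -/
theorem stmt_6 (n m : ℕ) (hn : 1 ≤ n) (hm : 1 ≤ m)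
    (ω : Fin n → Fin m → Fin m → ((Fin n → ℝ) × (Fin m → ℝ)) → ℝ)
    (ω₀ : Fin m → ((Fin n → ℝ) × (Fin m → ℝ)) → ℝ)
    (hωsmooth : ∀ i a b, ContDiff ℝ (⊤ : ℕ∞) (ω i a b))
    (hω₀smooth : ∀ a, ContDiff ℝ (⊤ : ℕ∞) (ω₀ a))
    (hskew : ∀ i a b p, ω i a b p = - ω i b a p)
    (hC1 : ∀ i a b c p, pdy a (ω i b c) p + pdy b (ω i c a) p + pdy c (ω i a b) p = 0)
    (hC2 : ∀ a b p,
      (∑ i, pdx i (ω i a b) p) + (1 / 2) * (pdy a (ω₀ b) p - pdy b (ω₀ a) p) = 0)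
    (Y₁ Y₂ : Fin m → ((Fin n → ℝ) × (Fin m → ℝ)) → ℝ)
    (f₁ f₂ : Fin n → ((Fin n → ℝ) × (Fin m → ℝ)) → ℝ)
    (h₁ : NoetherPair ω ω₀ Y₁ f₁) (h₂ : NoetherPair ω ω₀ Y₂ f₂) :
    NoetherPair ω ω₀
      (fun a p => ∑ c, (Y₁ c p * pdy c (Y₂ a) p - Y₂ c p * pdy c (Y₁ a) p))
      (fun i p => ∑ a, Y₁ a p * pdy a (f₂ i) p) ∧
    (∀ Y₁' : Fin m → ((Fin n → ℝ) × (Fin m → ℝ)) → ℝ,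
      NoetherPair ω ω₀ Y₁' f₁ →
      ∀ i p, (∑ a, Y₁ a p * pdy a (f₂ i) p) = ∑ a, Y₁' a p * pdy a (f₂ i) p) := by
  refine ⟨⟨fun a => ?_, fun i => ?_, h₁.pdy_lieDerivative hωsmooth hskew hC1 h₂,
    h₁.sum_pdx_lieDerivative hωsmooth hω₀smooth hskew hC2 h₂⟩, fun Y₁' h₁' i p => ?_⟩
  · exact ContDiff.sum fun c _ => ((h₁.1 c).mul ((h₂.1 a).pdy c)).sub
      ((h₂.1 c).mul ((h₁.1 a).pdy c))
  · exact ContDiff.sum fun a _ => (h₁.1 a).mul ((h₂.2.1 i).pdy a)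
  · rw [h₁.sum_mul_pdy_antisymm hskew h₂, h₁'.sum_mul_pdy_antisymm hskew h₂]
end

section
/- Work on P = ℝ^n × ℝ^m with coordinates (x^1,…,x^n,y^1,…,y^m), n ≥ 1, m ≥ 1. Let ω^i_{ab} : P → ℝ be infinitely differentiable (C^∞) with ω^i_{ab} = −ω^i_{ba}, and ω_a : P → ℝ be C^∞, satisfying (C1) ∂_{y^a}ω^i_{bc} + ∂_{y^b}ω^i_{ca} + ∂_{y^c}ω^i_{ab} = 0 and (C2) Σ_i ∂_{x^i}ω^i_{ab} + (1/2)(∂_{y^a}ω_b − ∂_{y^b}ω_a) = 0. Call (Y,f) a PD-Noether pair iff ∂_{y^b}f^i = 2 Σ_a ω^i_{ab} Y^a for all i,b and Σ_i ∂_{x^i}f^i = Σ_a ω_a Y^a. For PD-Noether pairs (Y₁,f₁), (Y₂,f₂), define the bracket {f₁,f₂}^i := Σ_a Y₁^a ∂_{y^a}f₂^i. Then: (1) skew-symmetry: Σ_a Y₁^a ∂_{y^a}f₂^i = − Σ_a Y₂^a ∂_{y^a}f₁^i everywhere; (2) Jacobi identity: if (Y₃,f₃) is a further PD-Noether pair,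 then, with Y₁₂^a := Σ_c ( Y₁^c ∂_{y^c}Y₂^a − Y₂^c ∂_{y^c}Y₁^a ), one has Σ_a Y₁^a ∂_{y^a}( Σ_b Y₂^b ∂_{y^b}f₃^i ) = Σ_a Y₁₂^a ∂_{y^a}f₃^i + Σ_a Y₂^a ∂_{y^a}( Σ_b Y₁^b ∂_{y^b}f₃^i ) for all i, everywhere on P. -/
open scoped BigOperators

section PartialDerivatives

variable {n m : ℕ}

theorem differentiable_pdy {f : (Fin n → ℝ) × (Fin m → ℝ) → ℝ} (hf : ContDiff ℝ 2 f)
    (a : Fin m) : Differentiable ℝ (pdy a f) :=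
  ((hf.fderiv_right (m := 1) le_rfl).differentiable one_ne_zero).clm_apply
    (differentiable_const _)

theorem pdy_comm {f : (Fin n → ℝ) × (Fin m → ℝ) → ℝ} (hf : ContDiff ℝ 2 f)
    (a b : Fin m) (p : (Fin n → ℝ) × (Fin m → ℝ)) :
    pdy a (pdy b f) p = pdy b (pdy a f) p := by
  have hd : DifferentiableAt ℝ (fderiv ℝ f) p :=
    (hf.fderiv_right (m := 1) le_rfl).differentiable one_ne_zero p
  have key (c d : Fin m) : pdy c (pdy d f) p =
      fderiv ℝ (fderiv ℝ f) p (0, Pi.single c 1) (0, Pi.single d 1) := by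
    change fderiv ℝ (fun q => fderiv ℝ f q (0, Pi.single d 1)) p _ = _
    rw [fderiv_clm_apply hd (differentiableAt_const _)]
    simp
  rw [key, key]
  exact (hf.contDiffAt.isSymmSndFDerivAt (by simp)).eq _ _

theorem pdy_sum_mul {Y g : Fin m → (Fin n → ℝ) × (Fin m → ℝ) → ℝ}
    (hY : ∀ b, Differentiable ℝ (Y b)) (hg : ∀ b, Differentiable ℝ (g b))
    (a : Fin m) (p : (Fin n → ℝ) × (Fin m → ℝ)) :
    pdy a (fun q => ∑ b, Y b q * g b q) p =
      ∑ b, (pdy a (Y b) p * g b p + Y b p * pdy a (g b) p) := by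
  unfold pdy
  rw [fderiv_fun_sum fun b _ => (hY b p).fun_mul (hg b p)]
  simp only [sum_apply]
  refine Finset.sum_congr rfl fun b _ => ?_
  rw [fderiv_fun_mul (hY b p) (hg b p)]
  simp only [add_apply, smul_apply, smul_eq_mul]
  ring

/-- The commutator of two fiberwise derivations is the derivation along their Lie bracket. -/
theorem fiber_derivation_commutator {Y Z : Fin m → (Fin n → ℝ) × (Fin m → ℝ) → ℝ}
    {f : (Fin n → ℝ) × (Fin m → ℝ) → ℝ}
    (hY : ∀ b, Differentiable ℝ (Y b)) (hZ : ∀ b, Differentiable ℝ (Z b))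
    (hf : ContDiff ℝ 2 f) (p : (Fin n → ℝ) × (Fin m → ℝ)) :
    (∑ a, Y a p * pdy a (fun q => ∑ b, Z b q * pdy b f q) p) =
      (∑ a, (∑ c, (Y c p * pdy c (Z a) p - Z c p * pdy c (Y a) p)) * pdy a f p) +
        ∑ a, Z a p * pdy a (fun q => ∑ b, Y b q * pdy b f q) p := by
  simp only [pdy_sum_mul hZ (differentiable_pdy hf), pdy_sum_mul hY (differentiable_pdy hf),
    Finset.mul_sum, Finset.sum_mul, mul_add, sub_mul, Finset.sum_add_distrib,
    Finset.sum_sub_distrib]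
  have second : (∑ a, ∑ b, Y a p * (Z b p * pdy a (pdy b f) p)) =
      ∑ a, ∑ b, Z a p * (Y b p * pdy a (pdy b f) p) := by
    rw [Finset.sum_comm]
    refine Finset.sum_congr rfl fun a _ => Finset.sum_congr rfl fun b _ => ?_
    rw [pdy_comm hf b a]
    ring
  have first (U V : Fin m → (Fin n → ℝ) × (Fin m → ℝ) → ℝ) :
      (∑ a, ∑ b, U a p * (pdy a (V b) p * pdy b f p)) =
        ∑ a, ∑ c, U c p * pdy c (V a) p * pdy a f p := by
    rw [Finset.sum_comm]
    simp only [mul_assoc]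
  rw [second, first Y Z, first Z Y]
  ring

end PartialDerivatives

/-- the PD-Poisson bracket `{f₁,f₂}^i = Σ_a Y₁^a ∂_{y^a} f₂^i` on
PD-Noether currents is skew-symmetric and satisfies the Jacobi identity. -/
theorem stmt_7 (n m : ℕ) (hn : 1 ≤ n) (hm : 1 ≤ m)
    (ω : Fin n → Fin m → Fin m → ((Fin n → ℝ) × (Fin m → ℝ)) → ℝ)
    (ω₀ : Fin m → ((Fin n → ℝ) × (Fin m → ℝ)) → ℝ)
    (hωsmooth : ∀ i a b, ContDiff ℝ (⊤ : ℕ∞) (ω i a b))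
    (hω₀smooth : ∀ a, ContDiff ℝ (⊤ : ℕ∞) (ω₀ a))
    (hskew : ∀ i a b p, ω i a b p = - ω i b a p)
    (hC1 : ∀ i a b c p, pdy a (ω i b c) p + pdy b (ω i c a) p + pdy c (ω i a b) p = 0)
    (hC2 : ∀ a b p,
      (∑ i, pdx i (ω i a b) p) + (1 / 2) * (pdy a (ω₀ b) p - pdy b (ω₀ a) p) = 0)
    (Y₁ Y₂ : Fin m → ((Fin n → ℝ) × (Fin m → ℝ)) → ℝ)
    (f₁ f₂ : Fin n → ((Fin n → ℝ) × (Fin m → ℝ)) → ℝ)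
    (h₁ : NoetherPair ω ω₀ Y₁ f₁) (h₂ : NoetherPair ω ω₀ Y₂ f₂) :
    (∀ i p, (∑ a, Y₁ a p * pdy a (f₂ i) p) = - ∑ a, Y₂ a p * pdy a (f₁ i) p) ∧
    (∀ (Y₃ : Fin m → ((Fin n → ℝ) × (Fin m → ℝ)) → ℝ)
       (f₃ : Fin n → ((Fin n → ℝ) × (Fin m → ℝ)) → ℝ),
      NoetherPair ω ω₀ Y₃ f₃ →
      ∀ i p,
        (∑ a, Y₁ a p * pdy a (fun p' => ∑ b, Y₂ b p' * pdy b (f₃ i) p') p) =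
          (∑ a, (∑ c, (Y₁ c p * pdy c (Y₂ a) p - Y₂ c p * pdy c (Y₁ a) p)) *
              pdy a (f₃ i) p) +
          ∑ a, Y₂ a p * pdy a (fun p' => ∑ b, Y₁ b p' * pdy b (f₃ i) p') p) := by
  obtain ⟨hY₁, -, hd₁, -⟩ := h₁
  obtain ⟨hY₂, -, hd₂, -⟩ := h₂
  refine ⟨fun i p => ?_, fun Y₃ f₃ h₃ i p => ?_⟩
  · simp only [hd₁, hd₂, Finset.mul_sum, ← Finset.sum_neg_distrib]
    rw [Finset.sum_comm]
    refine Finset.sum_congr rfl fun a _ => Finset.sum_congr rfl fun b _ => ?_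
    rw [hskew i a b p]
    ring
  · exact fiber_derivation_commutator (fun b => (hY₁ b).differentiable (by simp))
      (fun b => (hY₂ b).differentiable (by simp)) (contDiff_infty.1 (h₃.2.1 i) 2) p
end

section
/- Let n > 1. Work on ℝ^{2n+1} with coordinates (x^1,…,x^n,u,u_1,…,u_n). Let T : ℝ^n → ℝ be an infinitely differentiable (C^∞) function of (u_1,…,u_n) whose Hessian matrix T^{ij} := ∂²T/∂u_i∂u_j is invertible at every point. Let U, f^1,…,f^n be C^∞ functions on ℝ^{2n+1} satisfying, for all i,j: ∂_{u_j} f^i + T^{ij} U = 0. Then: (1) ∂_{u_j} U = 0 for all j (U does not depend on u_1,…,u_n); and (2) ∂_{u_j}( f^i + (∂T/∂u_i) U ) = 0 for all i,j, i.e. f^i = −(∂T/∂u_i) U + A^i where each A^i does not depend on u_1,…,u_n. -/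
open scoped BigOperators

/-- The space `ℝ^{2n+1}` with coordinates `(x^1,…,x^n, u, u_1,…,u_n)`. -/
abbrev Space (n : ℕ) := (Fin n → ℝ) × ℝ × (Fin n → ℝ)

/-- Partial derivative with respect to `u_j`. -/
noncomputable def pduj {n : ℕ} (j : Fin n) (f : Space n → ℝ) (p : Space n) : ℝ :=
  fderiv ℝ f p ((0 : Fin n → ℝ), (0 : ℝ), Pi.single j 1)

/-- Hessian `T^{ij} = ∂²T/∂u_i∂u_j` of a function `T` of `(u_1,…,u_n)`. -/
noncomputable def hessT {n : ℕ} (T : (Fin n → ℝ) → ℝ) (q : Fin n → ℝ)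
    (i j : Fin n) : ℝ :=
  fderiv ℝ (fun q' => fderiv ℝ T q' (Pi.single j 1)) q (Pi.single i 1)

theorem contDiff_fderiv_apply_const {E : Type*} [NormedAddCommGroup E] [NormedSpace ℝ E]
    {F : E → ℝ} (hF : ContDiff ℝ (⊤ : ℕ∞) F) (v : E) :
    ContDiff ℝ (⊤ : ℕ∞) (fun y => fderiv ℝ F y v) :=
  (hF.fderiv_right (m := (⊤ : ℕ∞)) (by simp)).clm_apply contDiff_const

/-- Iterated directional derivatives of a smooth function commute. -/
theorem fderiv_fderiv_apply_comm {E : Type*} [NormedAddCommGroup E] [NormedSpace ℝ E]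
    {F : E → ℝ} (hF : ContDiff ℝ (⊤ : ℕ∞) F) (x v w : E) :
    fderiv ℝ (fun y => fderiv ℝ F y v) x w = fderiv ℝ (fun y => fderiv ℝ F y w) x v := by
  have hd : DifferentiableAt ℝ (fderiv ℝ F) x :=
    ((hF.fderiv_right (m := (⊤ : ℕ∞)) (by simp)).differentiable (by simp)) x
  have hsymm : IsSymmSndFDerivAt ℝ F x :=
    hF.contDiffAt.isSymmSndFDerivAt (by
      rw [minSmoothness_of_isRCLikeNormedField]
      exact WithTop.coe_le_coe.2 (le_top (a := (2 : ℕ∞))))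
  have key (a b : E) :
      fderiv ℝ (fun y => fderiv ℝ F y a) x b = fderiv ℝ (fderiv ℝ F) x b a := by
    rw [fderiv_clm_apply hd (differentiableAt_const a)]
    simp
  rw [key, key]
  exact hsymm w v

theorem pduj_add {n : ℕ} (j : Fin n) {f g : Space n → ℝ} {p : Space n}
    (hf : DifferentiableAt ℝ f p) (hg : DifferentiableAt ℝ g p) :
    pduj j (fun q => f q + g q) p = pduj j f p + pduj j g p := by
  simp [pduj, fderiv_fun_add hf hg]

theorem pduj_mul {n : ℕ} (j : Fin n) {f g : Space n → ℝ} {p : Space n}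
    (hf : DifferentiableAt ℝ f p) (hg : DifferentiableAt ℝ g p) :
    pduj j (fun q => f q * g q) p = f p * pduj j g p + g p * pduj j f p := by
  simp [pduj, fderiv_fun_mul hf hg]

/-- The `u_j`-derivative of a function of `(u_1,…,u_n)` alone. -/
theorem pduj_comp_snd_snd {n : ℕ} (j : Fin n) {g : (Fin n → ℝ) → ℝ} {p : Space n}
    (hg : DifferentiableAt ℝ g p.2.2) :
    pduj j (fun q => g q.2.2) p = fderiv ℝ g p.2.2 (Pi.single j 1) := by
  have h : HasFDerivAt (fun q : Space n => q.2.2)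
      ((ContinuousLinearMap.snd ℝ ℝ (Fin n → ℝ)).comp
        (ContinuousLinearMap.snd ℝ (Fin n → ℝ) (ℝ × (Fin n → ℝ)))) p :=
    hasFDerivAt_snd.comp p hasFDerivAt_snd
  have hc := (hg.hasFDerivAt.comp p h).fderiv
  rw [pduj]
  change fderiv ℝ (g ∘ fun q : Space n => q.2.2) p _ = _
  rw [hc]
  simp

/-- If the rows `A k` of an invertible matrix of size at least two satisfy
`v j • A k = v k • A j` for all `j`, `k`, then `v = 0`. -/
theorem eq_zero_of_det_ne_zero_of_mul_eq_mul {n : ℕ} (hn : 1 < n)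
    {A : Matrix (Fin n) (Fin n) ℝ} (hA : A.det ≠ 0) {v : Fin n → ℝ}
    (h : ∀ j k i, A k i * v j = A j i * v k) (j : Fin n) : v j = 0 := by
  have : Nontrivial (Fin n) := Fin.nontrivial_iff_two_le.2 hn
  obtain ⟨k, hk⟩ := exists_ne j
  have hinv : A * A⁻¹ = 1 := Matrix.mul_nonsing_inv A (isUnit_iff_ne_zero.2 hA)
  have hsum : (A * A⁻¹) k k * v j = (A * A⁻¹) j k * v k := by
    simp only [Matrix.mul_apply, Finset.sum_mul]
    refine Finset.sum_congr rfl fun i _ => ?_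
    linear_combination A⁻¹ i k * h j k i
  simpa [hinv, Matrix.one_apply, hk.symm] using hsum

/-- from equation (18), `∂_{u_j} f^i + T^{ij} U = 0`, alone (with
`n > 1` and the Hessian of `T` everywhere invertible) it follows that `U` and
`f^i + (∂T/∂u_i) U` do not depend on the variables `u_1,…,u_n`. -/
theorem stmt_8 (n : ℕ) (hn : 1 < n)
    (T : (Fin n → ℝ) → ℝ) (hT : ContDiff ℝ (⊤ : ℕ∞) T)
    (hTinv : ∀ q : Fin n → ℝ, (Matrix.of fun i j => hessT T q i j).det ≠ 0)
    (U : Space n → ℝ) (f : Fin n → Space n → ℝ)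
    (hU : ContDiff ℝ (⊤ : ℕ∞) U) (hf : ∀ i, ContDiff ℝ (⊤ : ℕ∞) (f i))
    (h18 : ∀ (i j : Fin n) (p : Space n),
      pduj j (f i) p + hessT T p.2.2 i j * U p = 0) :
    (∀ (j : Fin n) (p : Space n), pduj j U p = 0) ∧
    (∀ (i j : Fin n) (p : Space n),
      pduj j (fun p' => f i p' + fderiv ℝ T p'.2.2 (Pi.single i 1) * U p') p = 0) := by
  have hdT (i : Fin n) : ContDiff ℝ (⊤ : ℕ∞) (fun q => fderiv ℝ T q (Pi.single i 1)) :=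
    contDiff_fderiv_apply_const hT _
  have hg (i : Fin n) :
      ContDiff ℝ (⊤ : ℕ∞) (fun p : Space n => fderiv ℝ T p.2.2 (Pi.single i 1)) :=
    (hdT i).comp (contDiff_snd.comp contDiff_snd)
  have hgd (i j : Fin n) (p : Space n) :
      pduj j (fun p' : Space n => fderiv ℝ T p'.2.2 (Pi.single i 1)) p
        = hessT T p.2.2 j i :=
    pduj_comp_snd_snd j ((hdT i).differentiable (by simp) _)
  have hsymm (q : Fin n → ℝ) (i j : Fin n) : hessT T q i j = hessT T q j i :=
    fderiv_fderiv_apply_comm hT q _ _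
  have hUd : ∀ p, DifferentiableAt ℝ U p := hU.differentiable (by simp)
  have hgD (i : Fin n) := (hg i).differentiable (by simp)
  have hF (i j : Fin n) (p : Space n) :
      pduj j (fun p' => f i p' + fderiv ℝ T p'.2.2 (Pi.single i 1) * U p') p
        = fderiv ℝ T p.2.2 (Pi.single i 1) * pduj j U p := by
    rw [pduj_add j ((hf i).differentiable (by simp) p) ((hgD i p).fun_mul (hUd p)),
      pduj_mul j (hgD i p) (hUd p), hgd]
    linear_combination h18 i j p + U p * hsymm p.2.2 j i
  have hU2 (j : Fin n) : ContDiff ℝ (⊤ : ℕ∞) (pduj j U) := contDiff_fderiv_apply_const hU _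
  have hUU (j k : Fin n) (p : Space n) : pduj k (pduj j U) p = pduj j (pduj k U) p :=
    fderiv_fderiv_apply_comm hU p _ _
  have hFF (i j k : Fin n) (p : Space n) :
      pduj k (pduj j (fun p' => f i p' + fderiv ℝ T p'.2.2 (Pi.single i 1) * U p')) p
        = fderiv ℝ T p.2.2 (Pi.single i 1) * pduj k (pduj j U) p
          + pduj j U p * hessT T p.2.2 k i := by
    rw [funext (hF i j), pduj_mul k (hgD i p) ((hU2 j).differentiable (by simp) p), hgd]
  have hU0 (j : Fin n) (p : Space n) : pduj j U p = 0 := by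
    refine eq_zero_of_det_ne_zero_of_mul_eq_mul hn (hTinv p.2.2)
      (v := fun j => pduj j U p) (fun j k i => ?_) j
    have hcomm :
        pduj k (pduj j (fun p' => f i p' + fderiv ℝ T p'.2.2 (Pi.single i 1) * U p')) p
          = pduj j (pduj k (fun p' => f i p' + fderiv ℝ T p'.2.2 (Pi.single i 1) * U p')) p :=
      fderiv_fderiv_apply_comm ((hf i).add ((hg i).mul hU)) p _ _
    rw [hFF, hFF, hUU j k p] at hcomm
    simp only [Matrix.of_apply]
    linear_combination hcomm
  exact ⟨hU0, fun i j p => by rw [hF, hU0, mul_zero]⟩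
end

section
/- Let n > 1. Work on ℝ^{2n+1} with coordinates (x^1,…,x^n,u,u_1,…,u_n). Let (g^{ij}) be a constant, symmetric, invertible real n×n matrix, let T := (1/2) Σ_{i,j} g^{ij} u_i u_j, and let V : ℝ → ℝ be C^∞ with V'''(u) ≠ 0 for all u. Let U, U_1,…,U_n, f^1,…,f^n be infinitely differentiable (C^∞) functions on ℝ^{2n+1} satisfying the PD-Noether equations: (16) Σ_i ∂_{x^i}f^i + Σ_{i,j} g^{ij} u_i U_j + V'(u) U = 0; (17) ∂_u f^i − Σ_j g^{ij} U_j = 0 for all i; (18) ∂_{u_j} f^i + g^{ij} U = 0 for all i,j. Then U = 0 identically, U_j = 0 identically for every j, each f^i is independent of u and of u_1,…,u_n (∂_u f^i = 0 and ∂_{u_k} f^i = 0 for all k), and Σ_i ∂_{x^i} f^i = 0. -/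
open scoped BigOperators

/-- Partial derivative with respect to `x^i`. -/
noncomputable def pdxi {n : ℕ} (i : Fin n) (f : Space n → ℝ) (p : Space n) : ℝ :=
  fderiv ℝ f p (Pi.single i 1, (0 : ℝ), (0 : Fin n → ℝ))

/-- Partial derivative with respect to `u`. -/
noncomputable def pdu {n : ℕ} (f : Space n → ℝ) (p : Space n) : ℝ :=
  fderiv ℝ f p ((0 : Fin n → ℝ), (1 : ℝ), (0 : Fin n → ℝ))

/-- A function with constant derivative along a line is affine on that line. -/
lemma apply_add_smul_of_fderiv_const {E : Type*} [NormedAddCommGroup E] [NormedSpace ℝ E]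
    {F : E → ℝ} (hF : Differentiable ℝ F) (p w : E) (c : ℝ)
    (h : ∀ t : ℝ, fderiv ℝ F (p + t • w) w = c) (t : ℝ) :
    F (p + t • w) = F p + t * c := by
  have hd : ∀ s : ℝ, HasDerivAt (fun s : ℝ => F (p + s • w) - s * c) 0 s := by
    intro s
    have h1 : HasDerivAt (fun s : ℝ => p + s • w) w s := by
      simpa using ((hasDerivAt_id s).smul_const w).const_add p
    have h2 := (hF (p + s • w)).hasFDerivAt.comp_hasDerivAt s h1
    rw [h s] at h2
    have h3 := HasDerivAt.fun_sub h2 ((hasDerivAt_id s).mul_const c)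
    simpa only [map_zero, one_mul, sub_self, Function.comp_apply, id_eq] using h3
  have := is_const_of_deriv_eq_zero (fun s => (hd s).differentiableAt) (fun s => (hd s).deriv) t 0
  simp only [zero_smul, add_zero, zero_mul, sub_zero] at this
  linarith

/-- If a translate of `F` equals `F` plus a multiple of `G`, so do the derivatives. -/
lemma fderiv_add_of_translate {E : Type*} [NormedAddCommGroup E] [NormedSpace ℝ E]
    {F G : E → ℝ} (hF : Differentiable ℝ F) (hG : Differentiable ℝ G) (w : E) (c : ℝ)
    (h : ∀ p, F (p + w) = F p + c * G p) (p d : E) :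
    fderiv ℝ F (p + w) d = fderiv ℝ F p d + c * fderiv ℝ G p d := by
  have h1 : (fun p => F (p + w)) = fun p => F p + c * G p := funext h
  have h2 := fderiv_comp_add_right (𝕜 := ℝ) (f := F) (x := p) w
  have h3 : HasFDerivAt (fun p => F p + c * G p) (fderiv ℝ F p + c • fderiv ℝ G p) p :=
    (hF p).hasFDerivAt.add ((hG p).hasFDerivAt.const_mul c)
  rw [← h2, h1, h3.fderiv]
  simp

/-- The derivative in a fibre direction, in terms of the partial derivatives `∂/∂u_j`. -/
lemma fderiv_momentum {n : ℕ} (F : Space n → ℝ) (p : Space n) (v : Fin n → ℝ) :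
    fderiv ℝ F p ((0 : Fin n → ℝ), (0 : ℝ), v) = ∑ j, v j * pduj j F p := by
  have := LinearMap.pi_apply_eq_sum_univ
    ((fderiv ℝ F p).toLinearMap ∘ₗ LinearMap.inr ℝ (Fin n → ℝ) (ℝ × (Fin n → ℝ)) ∘ₗ
      LinearMap.inr ℝ ℝ (Fin n → ℝ)) v
  simp only [LinearMap.coe_comp, Function.comp_apply, LinearMap.inr_apply,
    ContinuousLinearMap.coe_coe, smul_eq_mul] at this
  rw [this]
  refine Finset.sum_congr rfl fun j _ => ?_
  unfold pduj
  congr 4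
  ext k
  simp [Pi.single_apply, eq_comm]

/-- If the derivative of `V` times `c` is an affine function and the third derivative of `V` does not
vanish at `0`, then `c = 0`. -/
lemma coeff_eq_zero_of_deriv_affine {V : ℝ → ℝ} (hV''' : deriv (deriv (deriv V)) 0 ≠ 0)
    {a b c : ℝ} (h : ∀ t : ℝ, a + t * b + deriv V t * c = 0) : c = 0 := by
  by_contra hc
  have h1 : deriv V = fun t => (-b / c) * t + (-a / c) := by
    funext t
    field_simp
    linarith [h t]
  have h2 : deriv (deriv V) = fun _ => -b / c := by
    funext t
    rw [h1]
    simp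
  apply hV'''
  simp [h2]

/-- A symmetric matrix whose quadratic form vanishes is zero. -/
lemma eq_zero_of_quadratic_eq_zero {n : ℕ} {g : Fin n → Fin n → ℝ}
    (hgsymm : ∀ i j, g i j = g j i)
    (h : ∀ v : Fin n → ℝ, ∑ i, v i * ∑ j, v j * g i j = 0) (i j : Fin n) : g i j = 0 := by
  have hd : ∀ k, g k k = 0 := fun k => by
    simpa [Pi.single_apply] using h (Pi.single k 1)
  have := h (Pi.single i 1 + Pi.single j 1)
  simp [Pi.single_apply, add_mul, Finset.sum_add_distrib, hd] at this
  linarith [hgsymm i j]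

/-- If `∂f^i/∂u_j = -g^{ij} U` with `g` invertible and `n > 1`, then `U` is independent of the `u_j`. -/
lemma momentum_independent {n : ℕ} (hn : 1 < n) {g : Fin n → Fin n → ℝ}
    (hginv : (Matrix.of g).det ≠ 0) {U : Space n → ℝ} {f : Fin n → Space n → ℝ}
    (hf : ∀ i, Differentiable ℝ (f i))
    (h18 : ∀ (i j : Fin n) (p : Space n), pduj j (f i) p + g i j * U p = 0)
    (j : Fin n) (t : ℝ) (p : Space n) :
    U (p + t • ((0 : Fin n → ℝ), (0 : ℝ), Pi.single j 1)) = U p := by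
  have : Nontrivial (Fin n) := Fin.nontrivial_iff_two_le.mpr hn
  obtain ⟨l, hl⟩ := exists_ne j
  set B := (Matrix.of g)⁻¹ with hB
  have hBg : B * Matrix.of g = 1 := Matrix.nonsing_inv_mul _ (isUnit_iff_ne_zero.mpr hginv)
  let H : Space n → ℝ := fun p => ∑ i, B l i * f i p
  have hHd : Differentiable ℝ H := by
    intro p
    exact DifferentiableAt.fun_sum fun i _ => (hf i p).const_mul _
  have hH : ∀ k p, fderiv ℝ H p ((0 : Fin n → ℝ), (0 : ℝ), Pi.single k 1)
      = -((1 : Matrix (Fin n) (Fin n) ℝ) l k * U p) := by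
    intro k p
    have hs : HasFDerivAt H (∑ i, B l i • fderiv ℝ (f i) p) p :=
      HasFDerivAt.fun_sum fun i _ => (hf i p).hasFDerivAt.const_mul _
    rw [hs.fderiv, ← hBg, Matrix.mul_apply, Finset.sum_mul, ← Finset.sum_neg_distrib]
    simp only [sum_apply, smul_apply, smul_eq_mul,
      Matrix.of_apply]
    refine Finset.sum_congr rfl fun i _ => ?_
    have := h18 i k p
    unfold pduj at this
    rw [eq_neg_of_add_eq_zero_left this]
    ring
  have htr := fun q => apply_add_smul_of_fderiv_const hHd q
    ((0 : Fin n → ℝ), (0 : ℝ), Pi.single j 1) 0 (fun s => by rw [hH]; simp [hl]) t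
  have := fderiv_add_of_translate hHd hHd _ 0 (fun q => by rw [htr q]; simp) p
    ((0 : Fin n → ℝ), (0 : ℝ), Pi.single l 1)
  rw [hH, hH] at this
  simpa using this

/-- for `T = (1/2) g^{ij} u_i u_j` and a potential `V` with `V''' ≠ 0`
everywhere, the only PD-Noether symmetry/current pairs of the system are the
trivial ones: `U = 0`, `U_j = 0` and `f` (the pullback of) a closed `(n−1)`-form
on the base. -/
theorem stmt_9 (n : ℕ) (hn : 1 < n)
    (g : Fin n → Fin n → ℝ) (hgsymm : ∀ i j, g i j = g j i)
    (hginv : (Matrix.of g).det ≠ 0)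
    (V : ℝ → ℝ) (hV : ContDiff ℝ (⊤ : ℕ∞) V)
    (hV''' : ∀ u : ℝ, deriv (deriv (deriv V)) u ≠ 0)
    (U : Space n → ℝ) (Uj : Fin n → Space n → ℝ) (f : Fin n → Space n → ℝ)
    (hU : ContDiff ℝ (⊤ : ℕ∞) U) (hUj : ∀ j, ContDiff ℝ (⊤ : ℕ∞) (Uj j))
    (hf : ∀ i, ContDiff ℝ (⊤ : ℕ∞) (f i))
    (h16 : ∀ p : Space n,
      (∑ i, pdxi i (f i) p) + (∑ i, ∑ j, g i j * p.2.2 i * Uj j p) +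
        deriv V p.2.1 * U p = 0)
    (h17 : ∀ (i : Fin n) (p : Space n), pdu (f i) p - (∑ j, g i j * Uj j p) = 0)
    (h18 : ∀ (i j : Fin n) (p : Space n), pduj j (f i) p + g i j * U p = 0) :
    (∀ p : Space n, U p = 0) ∧
    (∀ (j : Fin n) (p : Space n), Uj j p = 0) ∧
    (∀ (i : Fin n) (p : Space n), pdu (f i) p = 0) ∧
    (∀ (i k : Fin n) (p : Space n), pduj k (f i) p = 0) ∧
    (∀ p : Space n, (∑ i, pdxi i (f i) p) = 0) := by
  have hUd : Differentiable ℝ U := hU.differentiable (by simp)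
  have hfd : ∀ i, Differentiable ℝ (f i) := fun i => (hf i).differentiable (by simp)
  have hUj0 : ∀ j p, pduj j U p = 0 := by
    intro j p
    have h := momentum_independent hn hginv hfd h18 j
    have h1 : HasDerivAt (fun s : ℝ => p + s • ((0 : Fin n → ℝ), (0 : ℝ), Pi.single j (1 : ℝ)))
        ((0 : Fin n → ℝ), (0 : ℝ), Pi.single j (1 : ℝ)) 0 := by
      simpa using ((hasDerivAt_id (0 : ℝ)).smul_const
        ((0 : Fin n → ℝ), (0 : ℝ), Pi.single j (1 : ℝ))).const_add p
    have h2 := (hUd _).hasFDerivAt.comp_hasDerivAt (0 : ℝ) h1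
    have h3 : (U ∘ fun s : ℝ => p + s • ((0 : Fin n → ℝ), (0 : ℝ), Pi.single j (1 : ℝ)))
        = fun _ => U p := funext fun s => h s p
    rw [h3] at h2
    simpa [pduj] using h2.unique (hasDerivAt_const (0 : ℝ) (U p))
  have hUv : ∀ (v : Fin n → ℝ) (p : Space n), U (p + ((0 : Fin n → ℝ), (0 : ℝ), v)) = U p := by
    intro v p
    have := apply_add_smul_of_fderiv_const hUd p ((0 : Fin n → ℝ), (0 : ℝ), v) 0
      (fun t => by rw [fderiv_momentum]; simp [hUj0]) 1
    simpa only [one_smul, mul_zero, add_zero] using this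
  have hfv : ∀ (i : Fin n) (v : Fin n → ℝ) (p : Space n),
      f i (p + ((0 : Fin n → ℝ), (0 : ℝ), v)) = f i p + (-∑ j, v j * g i j) * U p := by
    intro i v p
    have := apply_add_smul_of_fderiv_const (hfd i) p ((0 : Fin n → ℝ), (0 : ℝ), v)
      ((-∑ j, v j * g i j) * U p) (fun t => by
        have ht : t • (((0 : Fin n → ℝ), (0 : ℝ), v) : Space n) = (0, 0, t • v) := by simp
        rw [fderiv_momentum, ht, ← Finset.sum_neg_distrib, Finset.sum_mul]
        refine Finset.sum_congr rfl fun j _ => ?_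
        rw [eq_neg_of_add_eq_zero_left (h18 i j _), hUv]
        ring) 1
    simpa only [one_smul, one_mul] using this
  have hfv' := fun i v => fderiv_add_of_translate (hfd i) hUd _ _ (hfv i v)
  have hUv' : ∀ (v : Fin n → ℝ) (p d : Space n),
      fderiv ℝ U (p + ((0 : Fin n → ℝ), (0 : ℝ), v)) d = fderiv ℝ U p d := by
    intro v p d
    have := fderiv_add_of_translate hUd hUd _ 0 (fun q => by rw [hUv v q]; simp) p d
    simpa only [zero_mul, add_zero] using this
  have key : ∀ p : Space n,
      (∑ i, pdxi i (f i) p) + (∑ i, p.2.2 i * pdu (f i) p) + deriv V p.2.1 * U p = 0 := by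
    intro p
    rw [← h16 p]
    congr 2
    refine Finset.sum_congr rfl fun i _ => ?_
    rw [sub_eq_zero.mp (h17 i p), Finset.mul_sum]
    exact Finset.sum_congr rfl fun j _ => by ring
  have expand : ∀ (x : Fin n → ℝ) (u : ℝ) (v : Fin n → ℝ),
      ((∑ i, pdxi i (f i) (x, u, 0)) + deriv V u * U (x, u, 0))
        + (∑ i, v i * pdu (f i) (x, u, 0) - ∑ i, (∑ j, v j * g i j) * pdxi i U (x, u, 0))
        - (∑ i, v i * ∑ j, v j * g i j) * pdu U (x, u, 0) = 0 := by
    intro x u v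
    have h := key ((x, u, 0) + ((0 : Fin n → ℝ), (0 : ℝ), v))
    rw [hUv] at h
    unfold pdxi pdu at h ⊢
    simp only [hfv'] at h
    simp only [Prod.fst_add, Prod.snd_add, add_zero, zero_add, mul_add, neg_mul, mul_neg,
      Finset.sum_add_distrib, Finset.sum_neg_distrib] at h
    rw [Finset.sum_mul]
    simp only [mul_assoc]
    linarith
  have hzero : ∀ x u, (∑ i, pdxi i (f i) (x, u, 0)) + deriv V u * U (x, u, 0) = 0 := by
    intro x u
    simpa using expand x u 0
  have hquad : ∀ x u (v : Fin n → ℝ),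
      (∑ i, v i * ∑ j, v j * g i j) * pdu U (x, u, 0) = 0 := by
    intro x u v
    have h1 := expand x u v
    have h2 := expand x u (-v)
    simp only [Pi.neg_apply, neg_mul, mul_neg, neg_neg, Finset.sum_neg_distrib] at h2
    linarith [hzero x u]
  have hUu0 : ∀ x u, pdu U (x, u, 0) = 0 := by
    intro x u
    by_contra hne
    have hg := eq_zero_of_quadratic_eq_zero hgsymm
      (fun v => (mul_eq_zero.mp (hquad x u v)).resolve_right hne)
    apply hginv
    have : Nonempty (Fin n) := ⟨⟨0, by omega⟩⟩
    have : Matrix.of g = 0 := by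
      ext i j
      exact hg i j
    rw [this]
    exact Matrix.det_zero
  have hsplit : ∀ p : Space n, p = (p.1, p.2.1, 0) + ((0 : Fin n → ℝ), (0 : ℝ), p.2.2) := by
    intro p
    simp
  have hUu : ∀ p, fderiv ℝ U p ((0 : Fin n → ℝ), (1 : ℝ), (0 : Fin n → ℝ)) = 0 := by
    intro p
    rw [hsplit p, hUv']
    exact hUu0 _ _
  have hfu : ∀ k p, fderiv ℝ (f k) p ((0 : Fin n → ℝ), (1 : ℝ), (0 : Fin n → ℝ))
      = ∑ i, g i k * pdxi i U p := by
    intro k p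
    rw [hsplit p]
    unfold pdxi
    rw [hfv']
    simp only [hUv', hUu, mul_zero, add_zero]
    have h := expand p.1 p.2.1 (Pi.single k 1)
    rw [hzero, hUu0] at h
    simp [Pi.single_apply, pdu, pdxi] at h
    linarith
  have hUt : ∀ (t : ℝ) (p : Space n),
      U (p + t • ((0 : Fin n → ℝ), (1 : ℝ), (0 : Fin n → ℝ))) = U p := by
    intro t p
    simpa only [mul_zero, add_zero] using
      apply_add_smul_of_fderiv_const hUd p _ 0 (fun t => hUu _) t
  have hUt' : ∀ (t : ℝ) (p d : Space n),
      fderiv ℝ U (p + t • ((0 : Fin n → ℝ), (1 : ℝ), (0 : Fin n → ℝ))) d = fderiv ℝ U p d := by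
    intro t p d
    have := fderiv_add_of_translate hUd hUd _ 0 (fun q => by rw [hUt t q]; simp) p d
    simpa only [zero_mul, add_zero] using this
  let D : Fin n → Space n → ℝ := fun k p => ∑ i, g i k * pdxi i U p
  have hD : ∀ k, Differentiable ℝ (D k) := by
    intro k p
    have hU' : Differentiable ℝ (fderiv ℝ U) :=
      (hU.fderiv_right (m := (⊤ : ℕ∞)) le_rfl).differentiable (by simp)
    refine DifferentiableAt.fun_sum fun i _ => ?_
    unfold pdxi
    exact ((hU' p).clm_apply (differentiableAt_const _)).const_mul _
  have hft : ∀ (k : Fin n) (t : ℝ) (p : Space n),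
      f k (p + t • ((0 : Fin n → ℝ), (1 : ℝ), (0 : Fin n → ℝ))) = f k p + t * D k p := by
    intro k t p
    refine apply_add_smul_of_fderiv_const (hfd k) p _ (D k p) (fun s => ?_) t
    rw [hfu]
    simp only [D, pdxi, hUt']
  have hft' := fun k t => fderiv_add_of_translate (hfd k) (hD k) _ _ (hft k t)
  have hU0 : ∀ p, U p = 0 := by
    have hbase : ∀ x : Fin n → ℝ, U (x, 0, 0) = 0 := by
      intro x
      refine coeff_eq_zero_of_deriv_affine (hV''' 0) (a := ∑ i, pdxi i (f i) (x, 0, 0))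
        (b := ∑ i, pdxi i (D i) (x, 0, 0)) fun t => ?_
      have ht : ((x, t, 0) : Space n)
          = (x, 0, 0) + t • ((0 : Fin n → ℝ), (1 : ℝ), (0 : Fin n → ℝ)) := by simp
      have h := hzero x t
      rw [ht, hUt] at h
      unfold pdxi at h ⊢
      simp only [hft', Finset.sum_add_distrib, ← Finset.mul_sum] at h
      exact h
    intro p
    have hp : ((p.1, p.2.1, 0) : Space n)
        = (p.1, 0, 0) + p.2.1 • ((0 : Fin n → ℝ), (1 : ℝ), (0 : Fin n → ℝ)) := by simp
    rw [hsplit p, hUv, hp, hUt]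
    exact hbase _
  have hpdu : ∀ i p, pdu (f i) p = 0 := by
    intro i p
    have hz : U = fun _ => 0 := funext hU0
    refine (hfu i p).trans ?_
    simp [pdxi, hz]
  refine ⟨hU0, ?_, hpdu, fun i k p => by simpa [hU0] using h18 i k p, fun p => ?_⟩
  · intro j p
    have hmv : (Matrix.of g).mulVec (fun j => Uj j p) = 0 := by
      funext i
      have := h17 i p
      rw [hpdu] at this
      simpa [Matrix.mulVec, dotProduct] using this
    exact congrFun (Matrix.eq_zero_of_mulVec_eq_zero hginv hmv) j
  · simpa [hpdu, hU0] using key p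
end

section
/- Let m ≥ 1. Work on P = ℝ^{3m+2} × ℝ_{>0} with coordinates (q^1,…,q^m, s_1,…,s_m, t_1,…,t_m, s, t; e), fibered over ℝ² via (s,t). Set ε := (1/2)( Σ_γ t_γ² − 1 ). Suppose α, β, Q^1,…,Q^m, S_1,…,S_m, T_1,…,T_m, E are infinitely differentiable (C^∞) functions on P satisfying, for all γ = 1,…,m: ∂_s β − ∂_t α = Σ_γ ( s_γ S_γ − e t_γ T_γ ) − ε E; ∂_{q^γ} α = −T_γ; ∂_{q^γ} β = S_γ; ∂_{t_γ} α = ∂_{s_γ} β = Q^γ; ∂_{s_γ} α = ∂_{t_γ} β = 0; ∂_e α = ∂_e β = 0. Then there exist C^∞ functions A, B, C^1,…,C^m depending only on the variables (s, t, q^1,…,q^m) such that α = Σ_γ C^γ t_γ + A and β = Σ_γ C^γ s_γ + B; consequently Q^γ = C^γ, T_γ = −Σ_β (∂_{q^γ}C^β) t_β − ∂_{q^γ}A, and S_γ = Σ_β (∂_{q^γ}C^β) s_β + ∂_{q^γ}B. -/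
open scoped BigOperators

/-- The space `ℝ^{3m+2} × ℝ` with coordinates `(q, s_vec, t_vec, s, t, e)`;
the bundle of the example is the open subset where `e > 0`. -/
abbrev Tot (m : ℕ) :=
  (Fin m → ℝ) × (Fin m → ℝ) × (Fin m → ℝ) × ℝ × ℝ × ℝ

/-- The domain `ℝ^{3m+2} × ℝ_{>0}`. -/
def Dom (m : ℕ) : Set (Tot m) := {p | 0 < p.2.2.2.2.2}

/-- Partial derivative with respect to `q^γ`. -/
noncomputable def pdq {m : ℕ} (γ : Fin m) (f : Tot m → ℝ) (p : Tot m) : ℝ :=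
  fderiv ℝ f p (Pi.single γ 1, 0, 0, 0, 0, 0)

/-- Partial derivative with respect to `s_γ`. -/
noncomputable def pdsv {m : ℕ} (γ : Fin m) (f : Tot m → ℝ) (p : Tot m) : ℝ :=
  fderiv ℝ f p (0, Pi.single γ 1, 0, 0, 0, 0)

/-- Partial derivative with respect to `t_γ`. -/
noncomputable def pdtv {m : ℕ} (γ : Fin m) (f : Tot m → ℝ) (p : Tot m) : ℝ :=
  fderiv ℝ f p (0, 0, Pi.single γ 1, 0, 0, 0)

/-- Partial derivative with respect to the base coordinate `s`. -/
noncomputable def pds {m : ℕ} (f : Tot m → ℝ) (p : Tot m) : ℝ :=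
  fderiv ℝ f p (0, 0, 0, 1, 0, 0)

/-- Partial derivative with respect to the base coordinate `t`. -/
noncomputable def pdt {m : ℕ} (f : Tot m → ℝ) (p : Tot m) : ℝ :=
  fderiv ℝ f p (0, 0, 0, 0, 1, 0)

/-- Partial derivative with respect to `e`. -/
noncomputable def pde {m : ℕ} (f : Tot m → ℝ) (p : Tot m) : ℝ :=
  fderiv ℝ f p (0, 0, 0, 0, 0, 1)

/-- `ε = (1/2)(Σ_γ t_γ² − 1)`. -/
noncomputable def eps {m : ℕ} (p : Tot m) : ℝ :=
  (1 / 2) * ((∑ γ, (p.2.2.1 γ) ^ 2) - 1)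

/-- Partial derivative with respect to `q^γ` of a function of `(q, s, t)`. -/
noncomputable def pdqBase {m : ℕ} (γ : Fin m)
    (g : (Fin m → ℝ) × ℝ × ℝ → ℝ) (w : (Fin m → ℝ) × ℝ × ℝ) : ℝ :=
  fderiv ℝ g w (Pi.single γ 1, 0, 0)

/-- If the derivative of `f` in the direction `v` is constant along the segment from `x` to
`x + v`, then `f` grows by that constant along the segment. -/
theorem eq_add_of_fderiv_apply_const {V : Type*} [NormedAddCommGroup V] [NormedSpace ℝ V]
    {f : V → ℝ} {x v : V} {c : ℝ}
    (hf : ∀ r ∈ Set.Icc (0 : ℝ) 1, DifferentiableAt ℝ f (x + r • v))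
    (hc : ∀ r ∈ Set.Icc (0 : ℝ) 1, fderiv ℝ f (x + r • v) v = c) :
    f (x + v) = f x + c := by
  have hd : ∀ r ∈ Set.Icc (0 : ℝ) 1,
      HasDerivAt (fun r : ℝ => f (x + r • v) - r * c) 0 r := by
    intro r hr
    have hline : HasDerivAt (fun r : ℝ => x + r • v) v r := by
      simpa using ((hasDerivAt_id r).smul_const v).const_add x
    have := ((hf r hr).hasFDerivAt.comp_hasDerivAt r hline).sub
      ((hasDerivAt_id r).mul_const c)
    rw [hc r hr, one_mul, sub_self] at this
    exact this
  have hconst := constant_of_has_deriv_right_zero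
    (fun r hr => (hd r hr).continuousAt.continuousWithinAt)
    (fun r hr => (hd r (Set.Ico_subset_Icc_self hr)).hasDerivWithinAt) 1 (by simp)
  simp only [one_smul, one_mul, zero_smul, add_zero, zero_mul, sub_zero] at hconst
  linarith

/-- Two functions agreeing along parallel lines have the same directional derivative. -/
theorem fderiv_apply_eq_of_line {V W : Type*} [NormedAddCommGroup V] [NormedSpace ℝ V]
    [NormedAddCommGroup W] [NormedSpace ℝ W] {f : V → ℝ} {g : W → ℝ} {x v : V} {y w : W}
    (hf : DifferentiableAt ℝ f x) (hg : DifferentiableAt ℝ g y)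
    (h : ∀ r : ℝ, f (x + r • v) = g (y + r • w)) :
    fderiv ℝ f x v = fderiv ℝ g y w := by
  rw [← hf.lineDeriv_eq_fderiv, ← hg.lineDeriv_eq_fderiv, lineDeriv, lineDeriv, funext h]

theorem isOpen_Dom (m : ℕ) : IsOpen (Dom m) :=
  isOpen_lt continuous_const (by fun_prop)

theorem differentiableAt_of_contDiffOn_Dom {m : ℕ} {f : Tot m → ℝ}
    (hf : ContDiffOn ℝ (⊤ : ℕ∞) f (Dom m)) {p : Tot m} (hp : p ∈ Dom m) :
    DifferentiableAt ℝ f p :=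
  (hf.contDiffAt ((isOpen_Dom m).mem_nhds hp)).differentiableAt (by simp)

/-- The derivative along a vector tangent to the fibres of `(q, s, t)`, in terms of partial
derivatives. -/
theorem fderiv_fibre {m : ℕ} (f : Tot m → ℝ) (p : Tot m) (u v : Fin m → ℝ) (e : ℝ) :
    fderiv ℝ f p (0, u, v, 0, 0, e) =
      ∑ γ, u γ * pdsv γ f p + ∑ γ, v γ * pdtv γ f p + e * pde f p := by
  have hdecomp : ((0, u, v, 0, 0, e) : Tot m) =
      ∑ γ, u γ • ((0, Pi.single γ 1, 0, 0, 0, 0) : Tot m) +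
        ∑ γ, v γ • ((0, 0, Pi.single γ 1, 0, 0, 0) : Tot m) +
        e • ((0, 0, 0, 0, 0, 1) : Tot m) := by
    have hpi : ∀ x : Fin m → ℝ, ∑ γ, x γ • (Pi.single γ 1 : Fin m → ℝ) = x := fun x =>
      (pi_eq_sum_univ' x).symm ▸ by simp [← Pi.single_smul', Finset.univ_sum_single]
    simp only [Prod.ext_iff, Prod.fst_add, Prod.snd_add, Prod.fst_sum, Prod.snd_sum,
      Prod.smul_fst, Prod.smul_snd, hpi]
    simp
  rw [hdecomp]
  simp only [map_add, map_sum, map_smul, smul_eq_mul, pdsv, pdtv, pde]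

/-- The section `(q, s, t) ↦ (q, 0, 0, s, t, 1)` of the projection to the `(q, s, t)` space. -/
def baseSection {m : ℕ} (w : (Fin m → ℝ) × ℝ × ℝ) : Tot m :=
  (w.1, 0, 0, w.2.1, w.2.2, 1)

theorem ContDiffOn.comp_baseSection {m : ℕ} {f : Tot m → ℝ}
    (hf : ContDiffOn ℝ (⊤ : ℕ∞) f (Dom m)) :
    ContDiff ℝ (⊤ : ℕ∞) (fun w => f (baseSection w)) :=
  hf.comp_contDiff (f := baseSection) (by unfold baseSection; fun_prop)
    (fun w => by simp [Dom, baseSection])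

/-- If the fibre derivatives of `f` are constant on the fibres of `(q, s, t)`, then `f` is affine
on these fibres. -/
theorem eq_affine_of_fibre_derivatives {m : ℕ} {f : Tot m → ℝ}
    (hf : ContDiffOn ℝ (⊤ : ℕ∞) f (Dom m)) {q : Fin m → ℝ} {s t : ℝ}
    {u u' v v' : Fin m → ℝ} {e e' : ℝ} (he : 0 < e) (he' : 0 < e') {c : ℝ}
    (hc : ∀ x y : Fin m → ℝ, ∀ z : ℝ, 0 < z →
      fderiv ℝ f (q, x, y, s, t, z) (0, u' - u, v' - v, 0, 0, e' - e) = c) :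
    f (q, u', v', s, t, e') = f (q, u, v, s, t, e) + c := by
  have hpos : ∀ r ∈ Set.Icc (0 : ℝ) 1, 0 < e + r * (e' - e) := by
    rintro r ⟨h0, h1⟩
    rcases h0.eq_or_lt with rfl | h0
    · simpa using he
    · nlinarith [mul_pos h0 he', mul_nonneg (sub_nonneg.2 h1) he.le]
  have := eq_add_of_fderiv_apply_const (f := f) (x := (q, u, v, s, t, e))
    (v := (0, u' - u, v' - v, 0, 0, e' - e)) (c := c)
    (fun r hr => differentiableAt_of_contDiffOn_Dom hf (by simpa [Dom] using hpos r hr))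
    (fun r hr => by
      simpa using hc (u + r • (u' - u)) (v + r • (v' - v)) (e + r * (e' - e)) (hpos r hr))
  simpa using this

/-- The `q`-derivative of a function affine in `x`, with coefficients depending on
`(q, s, t)`. -/
theorem pdq_of_eq_affine {m : ℕ} {f : Tot m → ℝ}
    (hf : ContDiffOn ℝ (⊤ : ℕ∞) f (Dom m))
    {A : (Fin m → ℝ) × ℝ × ℝ → ℝ} {C : Fin m → (Fin m → ℝ) × ℝ × ℝ → ℝ}
    (hA : ContDiff ℝ (⊤ : ℕ∞) A) (hC : ∀ γ, ContDiff ℝ (⊤ : ℕ∞) (C γ))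
    {q u v : Fin m → ℝ} {s t e : ℝ} (he : 0 < e) (x : Fin m → ℝ)
    (h : ∀ q', f (q', u, v, s, t, e) = ∑ b, C b (q', s, t) * x b + A (q', s, t)) (γ : Fin m) :
    pdq γ f (q, u, v, s, t, e) =
      ∑ b, pdqBase γ (C b) (q, s, t) * x b + pdqBase γ A (q, s, t) := by
  have hA' : DifferentiableAt ℝ A (q, s, t) := hA.contDiffAt.differentiableAt (by simp)
  have hC' : ∀ b, DifferentiableAt ℝ (C b) (q, s, t) := fun b =>
    (hC b).contDiffAt.differentiableAt (by simp)
  have hd : HasFDerivAt (fun w => ∑ b, C b w * x b + A w)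
      (∑ b, x b • fderiv ℝ (C b) (q, s, t) + fderiv ℝ A (q, s, t)) (q, s, t) :=
    (HasFDerivAt.fun_sum fun b _ => (hC' b).hasFDerivAt.mul_const (x b)).add hA'.hasFDerivAt
  have := fderiv_apply_eq_of_line (x := (q, u, v, s, t, e)) (y := (q, s, t))
    (v := (Pi.single γ 1, 0, 0, 0, 0, 0)) (w := (Pi.single γ 1, 0, 0))
    (differentiableAt_of_contDiffOn_Dom hf he) hd.differentiableAt
    (fun r => by simpa using h (q + r • Pi.single γ 1))
  rw [pdq, this, hd.fderiv]
  simp [pdqBase, mul_comm]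

/-- solving the PD-Noether equations of the degenerate constrained
example: every PD-Noether current `f = α ds + β dt` has `α` affine in the
`t`-variables and `β` affine in the `s`-variables, with coefficients depending
only on `(q, s, t)`; the symmetry components are then determined. -/
theorem stmt_14 (m : ℕ) (hm : 1 ≤ m)
    (α β : Tot m → ℝ) (Q S T : Fin m → Tot m → ℝ) (Ef : Tot m → ℝ)
    (hα : ContDiffOn ℝ (⊤ : ℕ∞) α (Dom m)) (hβ : ContDiffOn ℝ (⊤ : ℕ∞) β (Dom m))
    (hQ : ∀ γ, ContDiffOn ℝ (⊤ : ℕ∞) (Q γ) (Dom m))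
    (hS : ∀ γ, ContDiffOn ℝ (⊤ : ℕ∞) (S γ) (Dom m))
    (hT : ∀ γ, ContDiffOn ℝ (⊤ : ℕ∞) (T γ) (Dom m))
    (hE : ContDiffOn ℝ (⊤ : ℕ∞) Ef (Dom m))
    (heq₁ : ∀ p ∈ Dom m,
      pds β p - pdt α p =
        (∑ γ, (p.2.1 γ * S γ p - p.2.2.2.2.2 * p.2.2.1 γ * T γ p)) - eps p * Ef p)
    (heq₂ : ∀ γ, ∀ p ∈ Dom m, pdq γ α p = - T γ p)
    (heq₃ : ∀ γ, ∀ p ∈ Dom m, pdq γ β p = S γ p)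
    (heq₄ : ∀ γ, ∀ p ∈ Dom m, pdtv γ α p = Q γ p)
    (heq₅ : ∀ γ, ∀ p ∈ Dom m, pdsv γ β p = Q γ p)
    (heq₆ : ∀ γ, ∀ p ∈ Dom m, pdsv γ α p = 0)
    (heq₇ : ∀ γ, ∀ p ∈ Dom m, pdtv γ β p = 0)
    (heq₈ : ∀ p ∈ Dom m, pde α p = 0)
    (heq₉ : ∀ p ∈ Dom m, pde β p = 0) :
    ∃ (A B : (Fin m → ℝ) × ℝ × ℝ → ℝ) (C : Fin m → (Fin m → ℝ) × ℝ × ℝ → ℝ),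
      ContDiff ℝ (⊤ : ℕ∞) A ∧ ContDiff ℝ (⊤ : ℕ∞) B ∧
      (∀ γ, ContDiff ℝ (⊤ : ℕ∞) (C γ)) ∧
      ∀ p ∈ Dom m,
        α p = (∑ γ, C γ (p.1, p.2.2.2.1, p.2.2.2.2.1) * p.2.2.1 γ) +
            A (p.1, p.2.2.2.1, p.2.2.2.2.1) ∧
        β p = (∑ γ, C γ (p.1, p.2.2.2.1, p.2.2.2.2.1) * p.2.1 γ) +
            B (p.1, p.2.2.2.1, p.2.2.2.2.1) ∧
        (∀ γ, Q γ p = C γ (p.1, p.2.2.2.1, p.2.2.2.2.1)) ∧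
        (∀ γ, T γ p =
          - (∑ b, pdqBase γ (C b) (p.1, p.2.2.2.1, p.2.2.2.2.1) * p.2.2.1 b) -
            pdqBase γ A (p.1, p.2.2.2.1, p.2.2.2.2.1)) ∧
        (∀ γ, S γ p =
          (∑ b, pdqBase γ (C b) (p.1, p.2.2.2.1, p.2.2.2.2.1) * p.2.1 b) +
            pdqBase γ B (p.1, p.2.2.2.1, p.2.2.2.2.1)) := by
  have h_one : (0 : ℝ) < 1 := one_pos
  have hαu : ∀ (q u u' v : Fin m → ℝ) (s t e e' : ℝ), 0 < e → 0 < e' →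
      α (q, u', v, s, t, e') = α (q, u, v, s, t, e) := by
    intro q u u' v s t e e' he he'
    simpa using eq_affine_of_fibre_derivatives hα (v := v) (v' := v) he he' (c := 0)
      fun x y z hz => by
        rw [fderiv_fibre, heq₈ _ hz]; simp [heq₆ _ (q, x, y, s, t, z) hz]
  have hβv : ∀ (q u v v' : Fin m → ℝ) (s t e e' : ℝ), 0 < e → 0 < e' →
      β (q, u, v', s, t, e') = β (q, u, v, s, t, e) := by
    intro q u v v' s t e e' he he'
    simpa using eq_affine_of_fibre_derivatives hβ (u := u) (u' := u) he he' (c := 0)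
      fun x y z hz => by
        rw [fderiv_fibre, heq₉ _ hz]; simp [heq₇ _ (q, x, y, s, t, z) hz]
  have hQC : ∀ γ (q u v : Fin m → ℝ) (s t e : ℝ), 0 < e →
      Q γ (q, u, v, s, t, e) = Q γ (baseSection (q, s, t)) := by
    intro γ q u v s t e he
    have h1 : Q γ (q, u, v, s, t, e) = Q γ (q, 0, v, s, t, 1) := by
      rw [← heq₄ γ _ he, ← heq₄ γ (q, 0, v, s, t, 1) h_one]
      exact fderiv_apply_eq_of_line (differentiableAt_of_contDiffOn_Dom hα he)
        (differentiableAt_of_contDiffOn_Dom hα (p := (q, 0, v, s, t, 1)) h_one)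
        fun r => by simpa using hαu q 0 u (v + r • Pi.single γ 1) s t 1 e h_one he
    have h2 : Q γ (q, 0, v, s, t, 1) = Q γ (q, 0, 0, s, t, 1) := by
      rw [← heq₅ γ (q, 0, v, s, t, 1) h_one, ← heq₅ γ (q, 0, 0, s, t, 1) h_one]
      exact fderiv_apply_eq_of_line
        (differentiableAt_of_contDiffOn_Dom hβ (p := (q, 0, v, s, t, 1)) h_one)
        (differentiableAt_of_contDiffOn_Dom hβ (p := (q, 0, 0, s, t, 1)) h_one)
        fun r => by simpa using hβv q (r • Pi.single γ 1) 0 v s t 1 1 h_one h_one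
    exact h1.trans h2
  have hαeq : ∀ (q u v : Fin m → ℝ) (s t e : ℝ), 0 < e → α (q, u, v, s, t, e) =
      ∑ γ, Q γ (baseSection (q, s, t)) * v γ + α (baseSection (q, s, t)) := by
    intro q u v s t e he
    rw [add_comm]
    exact eq_affine_of_fibre_derivatives hα h_one he fun x y z hz => by
      rw [fderiv_fibre, heq₈ _ hz]
      simp [heq₆ _ (q, x, y, s, t, z) hz, heq₄ _ (q, x, y, s, t, z) hz, hQC _ q x y s t z hz,
        mul_comm]
  have hβeq : ∀ (q u v : Fin m → ℝ) (s t e : ℝ), 0 < e → β (q, u, v, s, t, e) =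
      ∑ γ, Q γ (baseSection (q, s, t)) * u γ + β (baseSection (q, s, t)) := by
    intro q u v s t e he
    rw [add_comm]
    exact eq_affine_of_fibre_derivatives hβ h_one he fun x y z hz => by
      rw [fderiv_fibre, heq₉ _ hz]
      simp [heq₇ _ (q, x, y, s, t, z) hz, heq₅ _ (q, x, y, s, t, z) hz, hQC _ q x y s t z hz,
        mul_comm]
  refine ⟨fun w => α (baseSection w), fun w => β (baseSection w),
    fun γ w => Q γ (baseSection w), hα.comp_baseSection, hβ.comp_baseSection,
    fun γ => (hQ γ).comp_baseSection, ?_⟩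
  rintro ⟨q, u, v, s, t, e⟩ he
  refine ⟨hαeq q u v s t e he, hβeq q u v s t e he, fun γ => hQC γ q u v s t e he,
    fun γ => ?_, fun γ => ?_⟩
  · have := pdq_of_eq_affine hα hα.comp_baseSection (fun b => (hQ b).comp_baseSection)
      (q := q) he v (fun q' => hαeq q' u v s t e he) γ
    rw [heq₂ γ _ he] at this
    linarith
  · rw [← heq₃ γ _ he]
    exact pdq_of_eq_affine hβ hβ.comp_baseSection (fun b => (hQ b).comp_baseSection)
      he u (fun q' => hβeq q' u v s t e he) γ
end
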